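/- Define ρ*(r) = sup_{|x| = r} ρ(x) for r ≥ 0. If there exists η ≥ 0 such that ∫_η^∞ r^{α−1}·ρ*(r) dr < ∞, then ∫_{ℝ^N} ρ(y)·|y|^{-(N−α)} dy < ∞, and consequently the equation Δ^{α/2}u = ρ·φ(u) admits a nontrivial nonnegative entire bounded solution. -/

import Mathlib

open MeasureTheory Real Filter Topology

noncomputable section

/-- The constant `c_{N,-α} = 2^α · π^{-N/2} · Γ((N+α)/2) / |Γ(-α/2)|`. -/
def fracLapCoeff (N : ℕ) (α : ℝ) : ℝ :=
  2 ^ α * Real.pi ^ (-(N : ℝ) / 2) * Real.Gamma (((N : ℝ) + α) / 2) / |Real.Gamma (-α / 2)|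

/-- The fractional Laplacian `Δ^{α/2}θ` of a test function `θ`. -/
def fracLap (N : ℕ) (α : ℝ) (θ : EuclideanSpace ℝ (Fin N) → ℝ)
    (x : EuclideanSpace ℝ (Fin N)) : ℝ :=
  (fracLapCoeff N α / 2) *
    ∫ z : EuclideanSpace ℝ (Fin N), (θ (x + z) + θ (x - z) - 2 * θ x) / ‖z‖ ^ ((N : ℝ) + α)

/-- A nonnegative entire bounded (distributional) solution of `Δ^{α/2}u = ρ·φ(u)` on `ℝ^N`. -/
def IsEntireSol (N : ℕ) (α : ℝ) (ρ : EuclideanSpace ℝ (Fin N) → ℝ) (φ : ℝ → ℝ)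
    (u : EuclideanSpace ℝ (Fin N) → ℝ) : Prop :=
  Continuous u ∧ (∃ M, ∀ x, u x ≤ M) ∧ (∀ x, 0 ≤ u x) ∧
  LocallyIntegrable (fun x => ρ x * φ (u x)) ∧
  ∀ θ : EuclideanSpace ℝ (Fin N) → ℝ, ContDiff ℝ (⊤ : ℕ∞) θ → HasCompactSupport θ →
    (∫ x, u x * fracLap N α θ x) = ∫ x, ρ x * φ (u x) * θ x

/-- The coefficients of `(1 - x) ^ (-β)`. -/
def binCoeff (β : ℝ) (n : ℕ) : ℝ := (-1) ^ n * Ring.choose (-β) n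

lemma binCoeff_zero (β : ℝ) : binCoeff β 0 = 1 := by simp [binCoeff]

lemma binCoeff_succ (β : ℝ) (n : ℕ) :
    binCoeff β (n + 1) * (n + 1) = binCoeff β n * (β + n) := by
  have h := Ring.choose_smul_choose (-β) (Nat.le_succ n)
  rw [Nat.succ_eq_add_one, Nat.choose_succ_self_right, Nat.add_sub_cancel_left,
    Ring.choose_one_right, nsmul_eq_mul] at h
  push_cast at h
  simp only [binCoeff, pow_succ]
  linear_combination (-(-1) ^ n) * h

lemma binCoeff_pos {β : ℝ} (hβ : 0 < β) (n : ℕ) : 0 < binCoeff β n := by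
  induction n with
  | zero => simp [binCoeff_zero]
  | succ n ih =>
    have h := binCoeff_succ β n
    have h1 : 0 < binCoeff β n * (β + n) := by positivity
    rw [← h] at h1
    exact pos_of_mul_pos_left h1 (by positivity)

lemma binCoeff_neg {a : ℝ} (ha : 0 < a) (ha1 : a < 1) (n : ℕ) : binCoeff (-a) (n + 1) < 0 := by
  induction n with
  | zero =>
    have h := binCoeff_succ (-a) 0
    simp [binCoeff_zero] at h
    simp [h, ha]
  | succ n ih =>
    have h := binCoeff_succ (-a) (n + 1)
    have h2 : 0 < -a + ((n + 1 : ℕ) : ℝ) := by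
      push_cast
      have : (0 : ℝ) ≤ n := by positivity
      linarith
    have h1 : binCoeff (-a) (n + 1) * (-a + ((n + 1 : ℕ) : ℝ)) < 0 := mul_neg_of_neg_of_pos ih h2
    rw [← h] at h1
    exact neg_of_mul_neg_left h1 (by positivity)

lemma sum_antidiagonal_binCoeff (a : ℝ) (n : ℕ) :
    ∑ ij ∈ Finset.HasAntidiagonal.antidiagonal n, binCoeff a ij.1 * binCoeff (-a) ij.2 =
      if n = 0 then 1 else 0 := by
  have h := Ring.add_choose_eq (r := -a) (s := a) n (Commute.all _ _)
  rw [neg_add_cancel, Ring.choose_zero_ite] at h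
  have : ∑ ij ∈ Finset.HasAntidiagonal.antidiagonal n, binCoeff a ij.1 * binCoeff (-a) ij.2 =
      (-1) ^ n * ∑ ij ∈ Finset.HasAntidiagonal.antidiagonal n, Ring.choose (-a) ij.1 * Ring.choose a ij.2 := by
    rw [Finset.mul_sum]
    refine Finset.sum_congr rfl fun ij hij => ?_
    rw [← Finset.HasAntidiagonal.mem_antidiagonal.1 hij, pow_add]
    simp only [binCoeff, neg_neg]
    ring
  rw [this, ← h]
  split_ifs with h0 <;> simp [h0]

lemma hasSum_binCoeff (β : ℝ) {r : ℝ} (h0 : 0 ≤ r) (h1 : r < 1) :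
    HasSum (fun n => binCoeff β n * r ^ n) ((1 - r) ^ (-β)) := by
  have h := (one_add_rpow_hasFPowerSeriesOnBall_zero (a := -β)).hasSum (y := -r) (by
    simp only [edist_zero_right, Metric.mem_eball]
    rw [← ofReal_norm]
    simpa [abs_of_nonneg h0] using h1)
  rw [zero_add, ← sub_eq_add_neg] at h
  convert! h using 2 with n
  rw [binomialSeries_apply]
  simp only [binCoeff, List.ofFn_const, List.prod_replicate, smul_eq_mul]
  rw [neg_pow r]
  ring

lemma prod_eq_binCoeff (β : ℝ) (n : ℕ) :
    ∏ j ∈ Finset.range n, (β + j) = binCoeff β n * n.factorial := by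
  induction n with
  | zero => simp [binCoeff_zero]
  | succ n ih =>
    rw [Finset.prod_range_succ, ih, Nat.factorial_succ]
    push_cast
    linear_combination (-(n.factorial : ℝ)) * binCoeff_succ β n

lemma tendsto_binCoeff {β : ℝ} (hβ : Gamma β ≠ 0) :
    Tendsto (fun n : ℕ => (n : ℝ) ^ (1 - β) * binCoeff β n) atTop (𝓝 (Gamma β)⁻¹) := by
  rw [← tendsto_add_atTop_iff_nat 1]
  have h1 := (GammaSeq_tendsto_Gamma β).inv₀ hβ
  have h2 : Tendsto (fun n : ℕ => ((n : ℝ) / (n + 1)) ^ β) atTop (𝓝 1) := by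
    have := (tendsto_natCast_div_add_atTop (1 : ℝ)).rpow_const (p := β) (Or.inl one_ne_zero)
    simpa using this
  have h3 := h1.mul h2
  rw [mul_one] at h3
  refine h3.congr' ?_
  filter_upwards [eventually_gt_atTop 0] with n hn
  have hn' : (0 : ℝ) < n := by exact_mod_cast hn
  have hn1 : (0 : ℝ) < n + 1 := by positivity
  rw [GammaSeq, prod_eq_binCoeff, inv_div, div_rpow hn'.le hn1.le, Nat.factorial_succ]
  push_cast
  rw [rpow_sub hn1, rpow_one]
  have : (n.factorial : ℝ) ≠ 0 := by positivity
  have := (rpow_pos_of_pos hn' β).ne'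
  have := (rpow_pos_of_pos hn1 β).ne'
  field_simp

/-- Coefficients of `(1 - x) ^ (-a) - 1`. -/
def potCoeff (a : ℝ) (n : ℕ) : ℝ := if n = 0 then 0 else binCoeff a n

/-- Coefficients of `1 - (1 - x) ^ a`. -/
def jumpCoeff (a : ℝ) (n : ℕ) : ℝ := if n = 0 then 0 else -binCoeff (-a) n

lemma potCoeff_nonneg {a : ℝ} (ha : 0 < a) (n : ℕ) : 0 ≤ potCoeff a n := by
  unfold potCoeff
  split_ifs
  exacts [le_rfl, (binCoeff_pos ha n).le]

lemma jumpCoeff_nonneg {a : ℝ} (ha : 0 < a) (ha1 : a < 1) (n : ℕ) : 0 ≤ jumpCoeff a n := by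
  unfold jumpCoeff
  split_ifs with h
  · exact le_rfl
  · obtain ⟨m, rfl⟩ := Nat.exists_eq_succ_of_ne_zero h
    exact (neg_pos.2 (binCoeff_neg ha ha1 m)).le

lemma potCoeff_eq (a : ℝ) (n : ℕ) : potCoeff a n = binCoeff a n - if n = 0 then 1 else 0 := by
  unfold potCoeff
  split_ifs with h <;> simp [h, binCoeff_zero]

lemma jumpCoeff_eq (a : ℝ) (n : ℕ) :
    jumpCoeff a n = (if n = 0 then 1 else 0) - binCoeff (-a) n := by
  unfold jumpCoeff
  split_ifs with h <;> simp [h, binCoeff_zero]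

lemma potCoeff_renewal (a : ℝ) (n : ℕ) :
    potCoeff a n = jumpCoeff a n +
      ∑ ij ∈ Finset.HasAntidiagonal.antidiagonal n, potCoeff a ij.1 * jumpCoeff a ij.2 := by
  have h1 : ∀ ij : ℕ × ℕ, potCoeff a ij.1 * jumpCoeff a ij.2 =
      (binCoeff a ij.1 * (if ij.2 = 0 then 1 else 0) - binCoeff a ij.1 * binCoeff (-a) ij.2) -
      ((if ij.1 = 0 then (1 : ℝ) else 0) * (if ij.2 = 0 then 1 else 0) -
        (if ij.1 = 0 then 1 else 0) * binCoeff (-a) ij.2) := by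
    intro ij
    rw [potCoeff_eq, jumpCoeff_eq]
    ring
  have h2 : ∀ f : ℕ → ℝ, ∑ ij ∈ Finset.HasAntidiagonal.antidiagonal n, f ij.1 * (if ij.2 = 0 then 1 else 0)
      = f n := by
    intro f
    rw [Finset.Nat.sum_antidiagonal_eq_sum_range_succ (fun i j => f i * (if j = 0 then 1 else 0)),
      Finset.sum_range_succ, Finset.sum_eq_zero]
    · simp
    · intro i hi
      have : n - i ≠ 0 := by have := Finset.mem_range.1 hi; omega
      simp [this]
  have h3 : ∀ f : ℕ → ℝ, ∑ ij ∈ Finset.HasAntidiagonal.antidiagonal n, (if ij.1 = 0 then 1 else 0) * f ij.2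
      = f n := by
    intro f
    rw [← h2 f, ← Finset.Nat.sum_antidiagonal_swap]
    simp [mul_comm]
  simp only [h1, Finset.sum_sub_distrib]
  rw [h2, h3 (fun j => if j = 0 then 1 else 0), h3, sum_antidiagonal_binCoeff, potCoeff_eq,
    jumpCoeff_eq]
  ring

lemma summable_potCoeff (a : ℝ) {r : ℝ} (h0 : 0 ≤ r) (h1 : r < 1) :
    Summable (fun n => potCoeff a n * r ^ n) := by
  have : Summable (fun n : ℕ => (if n = 0 then (1 : ℝ) else 0) * r ^ n) :=
    (hasSum_ite_eq 0 (1 : ℝ)).summable.congr fun n => by split_ifs with h <;> simp [h]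
  exact ((hasSum_binCoeff a h0 h1).summable.sub this).congr fun n => by
    rw [potCoeff_eq]; ring

lemma hasSum_jumpCoeff (a : ℝ) {r : ℝ} (h0 : 0 ≤ r) (h1 : r < 1) :
    HasSum (fun n => jumpCoeff a n * r ^ n) (1 - (1 - r) ^ a) := by
  have h2 : HasSum (fun n : ℕ => (if n = 0 then (1 : ℝ) else 0) * r ^ n) 1 := by
    convert! hasSum_ite_eq 0 (1 : ℝ) using 2 with n
    split_ifs with h <;> simp [h]
  have h3 := hasSum_binCoeff (-a) h0 h1
  rw [neg_neg] at h3
  convert! h2.sub h3 using 2 with n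
  rw [jumpCoeff_eq]; ring

lemma tendsto_potCoeff {a : ℝ} (ha : 0 < a) :
    Tendsto (fun n : ℕ => (n : ℝ) ^ (1 - a) * potCoeff a n) atTop (𝓝 (Gamma a)⁻¹) := by
  refine (tendsto_binCoeff (Gamma_pos_of_pos ha).ne').congr' ?_
  filter_upwards [eventually_ne_atTop 0] with n hn
  simp [potCoeff, hn]

lemma Gamma_neg_lt_zero {a : ℝ} (ha : 0 < a) (ha1 : a < 1) : Gamma (-a) < 0 := by
  have h := Gamma_add_one (s := -a) (by linarith)
  have h2 : 0 < Gamma (-a + 1) := Gamma_pos_of_pos (by linarith)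
  rw [h] at h2
  nlinarith

lemma tendsto_jumpCoeff {a : ℝ} (ha : 0 < a) (ha1 : a < 1) :
    Tendsto (fun n : ℕ => (n : ℝ) ^ (1 - -a) * jumpCoeff a n) atTop (𝓝 (-(Gamma (-a))⁻¹)) := by
  refine (tendsto_binCoeff (β := -a) (Gamma_neg_lt_zero ha ha1).ne).neg.congr' ?_
  filter_upwards [eventually_ne_atTop 0] with n hn
  simp [jumpCoeff, hn]

/-- The space `ℝ^N`. -/
abbrev Eucl (N : ℕ) := EuclideanSpace ℝ (Fin N)

/-- The heat kernel on `ℝ^N` at time `s / 4`. -/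
def heatK (N : ℕ) (s : ℝ) (x : Eucl N) : ℝ :=
  (π * s) ^ (-((N : ℝ) / 2)) * exp (-‖x‖ ^ 2 / s)

lemma heatK_nonneg (N : ℕ) {s : ℝ} (hs : 0 ≤ s) (x : Eucl N) : 0 ≤ heatK N s x := by
  unfold heatK; positivity

lemma heatK_neg (N : ℕ) (s : ℝ) (x : Eucl N) : heatK N s (-x) = heatK N s x := by
  simp [heatK]

lemma continuous_heatK (N : ℕ) (s : ℝ) : Continuous (heatK N s) := by
  unfold heatK; fun_prop

lemma heatK_zero {N : ℕ} (hN : N ≠ 0) (x : Eucl N) : heatK N 0 x = 0 := by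
  have : -((N : ℝ) / 2) ≠ 0 := by
    have : (N : ℝ) ≠ 0 := by exact_mod_cast hN
    simpa using this
  simp [heatK, zero_rpow this]

lemma heatK_le (N : ℕ) {s : ℝ} (hs : 0 < s) (x : Eucl N) :
    heatK N s x ≤ (π * s) ^ (-((N : ℝ) / 2)) := by
  unfold heatK
  refine mul_le_of_le_one_right (by positivity) ?_
  rw [exp_le_one_iff, neg_div]
  have : 0 ≤ ‖x‖ ^ 2 / s := by positivity
  linarith

lemma integral_heatK (N : ℕ) {s : ℝ} (hs : 0 < s) : ∫ x, heatK N s x = 1 := by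
  have h := GaussianFourier.integral_rexp_neg_mul_sq_norm (V := Eucl N) (inv_pos.2 hs)
  have h2 : ∀ x : Eucl N, heatK N s x =
      (π * s) ^ (-((N : ℝ) / 2)) * exp (-s⁻¹ * ‖x‖ ^ 2) := by
    intro x
    rw [heatK]
    congr 2
    field_simp
  simp_rw [h2]
  rw [integral_const_mul, h, finrank_euclideanSpace_fin, div_inv_eq_mul, rpow_neg (by positivity),
    inv_mul_cancel₀ (by positivity)]

lemma integrable_heatK (N : ℕ) {s : ℝ} (hs : 0 < s) : Integrable (heatK N s) :=
  Integrable.of_integral_ne_zero (by rw [integral_heatK N hs]; exact one_ne_zero)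

lemma lintegral_heatK (N : ℕ) {s : ℝ} (hs : 0 < s) :
    ∫⁻ x, ENNReal.ofReal (heatK N s x) = 1 := by
  rw [← ofReal_integral_eq_lintegral_ofReal (integrable_heatK N hs)
    (ae_of_all _ (heatK_nonneg N hs.le)), integral_heatK N hs, ENNReal.ofReal_one]

lemma heatK_mul_heatK (N : ℕ) {s t : ℝ} (hs : 0 < s) (ht : 0 < t) (x y : Eucl N) :
    heatK N s (x - y) * heatK N t y =
      heatK N (s + t) x * heatK N (s * t / (s + t)) (y - (t / (s + t)) • x) := by
  have hst : 0 < s + t := by positivity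
  have h1 : (π * s) ^ (-((N : ℝ) / 2)) * (π * t) ^ (-((N : ℝ) / 2)) =
      (π * (s + t)) ^ (-((N : ℝ) / 2)) * (π * (s * t / (s + t))) ^ (-((N : ℝ) / 2)) := by
    rw [← mul_rpow (by positivity) (by positivity), ← mul_rpow (by positivity) (by positivity)]
    congr 1
    field_simp
  have h2 : -‖x - y‖ ^ 2 / s + -‖y‖ ^ 2 / t =
      -‖x‖ ^ 2 / (s + t) + -‖y - (t / (s + t)) • x‖ ^ 2 / (s * t / (s + t)) := by
    rw [norm_sub_sq_real, norm_sub_sq_real, norm_smul, inner_smul_right, real_inner_comm x y,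
      norm_of_nonneg (by positivity)]
    field_simp
    ring
  unfold heatK
  rw [mul_mul_mul_comm, mul_mul_mul_comm ((π * (s + t)) ^ (-((N : ℝ) / 2))), ← exp_add,
    ← exp_add, h1, h2]

lemma lintegral_heatK_conv (N : ℕ) {s t : ℝ} (hs : 0 < s) (ht : 0 < t) (x : Eucl N) :
    ∫⁻ y, ENNReal.ofReal (heatK N s (x - y)) * ENNReal.ofReal (heatK N t y) =
      ENNReal.ofReal (heatK N (s + t) x) := by
  have hst : 0 < s + t := by positivity
  simp_rw [← ENNReal.ofReal_mul (heatK_nonneg N hs.le _), heatK_mul_heatK N hs ht,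
    ENNReal.ofReal_mul (heatK_nonneg N hst.le _)]
  rw [lintegral_const_mul' _ _ ENNReal.ofReal_ne_top,
    lintegral_sub_right_eq_self (fun y => ENNReal.ofReal (heatK N (s * t / (s + t)) y)),
    lintegral_heatK N (by positivity), mul_one]

/-- The superposition `∑ k, q k * heatK (k * ε)` of heat kernels. -/
def heatSum (N : ℕ) (ε : ℝ) (q : ℕ → ℝ) (x : Eucl N) : ℝ := ∑' k : ℕ, q k * heatK N (k * ε) x

section heatSum

variable {N : ℕ} {ε : ℝ} {q : ℕ → ℝ}

lemma heatSum_term_nonneg (hε : 0 < ε) (hq : ∀ k, 0 ≤ q k) (x : Eucl N) (k : ℕ) :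
    0 ≤ q k * heatK N (k * ε) x := mul_nonneg (hq k) (heatK_nonneg N (by positivity) x)

lemma heatSum_nonneg (hε : 0 < ε) (hq : ∀ k, 0 ≤ q k) (x : Eucl N) : 0 ≤ heatSum N ε q x :=
  tsum_nonneg (heatSum_term_nonneg hε hq x)

lemma heatSum_neg (x : Eucl N) : heatSum N ε q (-x) = heatSum N ε q x := by
  simp [heatSum, heatK_neg]

lemma summable_heatSum (hN : N ≠ 0) (hε : 0 < ε) (hq : ∀ k, 0 ≤ q k) (hs : Summable q)
    (x : Eucl N) : Summable fun k : ℕ => q k * heatK N (k * ε) x := by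
  refine Summable.of_nonneg_of_le (heatSum_term_nonneg hε hq x) (fun k => ?_)
    (hs.mul_right ((π * ε) ^ (-((N : ℝ) / 2))))
  refine mul_le_mul_of_nonneg_left ?_ (hq k)
  rcases Nat.eq_zero_or_pos k with rfl | hk
  · simp only [Nat.cast_zero, zero_mul]
    rw [heatK_zero hN]
    positivity
  · have hk1 : (1 : ℝ) ≤ k := by exact_mod_cast hk
    refine (heatK_le N (by positivity) x).trans ?_
    refine rpow_le_rpow_of_nonpos (by positivity) ?_ (by simp; positivity)
    gcongr
    nlinarith

lemma ofReal_heatSum (hN : N ≠ 0) (hε : 0 < ε) (hq : ∀ k, 0 ≤ q k) (hs : Summable q)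
    (x : Eucl N) : ENNReal.ofReal (heatSum N ε q x) =
      ∑' k : ℕ, ENNReal.ofReal (q k) * ENNReal.ofReal (heatK N (k * ε) x) := by
  rw [heatSum, ENNReal.ofReal_tsum_of_nonneg (heatSum_term_nonneg hε hq x)
    (summable_heatSum hN hε hq hs x)]
  simp_rw [ENNReal.ofReal_mul (hq _)]

lemma measurable_heatSum (hN : N ≠ 0) (hε : 0 < ε) (hq : ∀ k, 0 ≤ q k) (hs : Summable q) :
    Measurable (heatSum N ε q) := by
  have h : Measurable fun x : Eucl N => (ENNReal.ofReal (heatSum N ε q x)).toReal := by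
    simp_rw [ofReal_heatSum hN hε hq hs]
    refine (Measurable.tsum fun k => ?_).ennreal_toReal
    exact ((continuous_heatK N _).measurable.ennreal_ofReal).const_mul _
  simpa only [ENNReal.toReal_ofReal (heatSum_nonneg hε hq _)] using h

lemma lintegral_heatSum (hN : N ≠ 0) (hε : 0 < ε) (hq : ∀ k, 0 ≤ q k) (hs : Summable q)
    (hq0 : q 0 = 0) :
    ∫⁻ x, ENNReal.ofReal (heatSum N ε q x) = ENNReal.ofReal (∑' k, q k) := by
  simp_rw [ofReal_heatSum hN hε hq hs]
  rw [lintegral_tsum fun k =>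
    (((continuous_heatK N _).measurable.ennreal_ofReal).const_mul _).aemeasurable,
    ENNReal.ofReal_tsum_of_nonneg hq hs]
  congr 1
  ext k
  rw [lintegral_const_mul' _ _ ENNReal.ofReal_ne_top]
  rcases Nat.eq_zero_or_pos k with rfl | hk
  · simp [hq0]
  · rw [lintegral_heatK N (by positivity), mul_one]

lemma integrable_heatSum (hN : N ≠ 0) (hε : 0 < ε) (hq : ∀ k, 0 ≤ q k) (hs : Summable q)
    (hq0 : q 0 = 0) : Integrable (heatSum N ε q) := by
  refine ⟨(measurable_heatSum hN hε hq hs).aestronglyMeasurable, ?_⟩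
  rw [hasFiniteIntegral_iff_ofReal (ae_of_all _ (heatSum_nonneg hε hq)),
    lintegral_heatSum hN hε hq hs hq0]
  exact ENNReal.ofReal_lt_top

lemma integral_heatSum (hN : N ≠ 0) (hε : 0 < ε) (hq : ∀ k, 0 ≤ q k) (hs : Summable q)
    (hq0 : q 0 = 0) : ∫ x, heatSum N ε q x = ∑' k, q k := by
  rw [integral_eq_lintegral_of_nonneg_ae (ae_of_all _ (heatSum_nonneg hε hq))
    (measurable_heatSum hN hε hq hs).aestronglyMeasurable,
    lintegral_heatSum hN hε hq hs hq0, ENNReal.toReal_ofReal (tsum_nonneg hq)]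

lemma ENNReal_tsum_mul_tsum_antidiagonal (f g h : ℕ → ENNReal) :
    ∑' j, ∑' k, f j * g k * h (j + k) =
      ∑' n, (∑ ij ∈ Finset.HasAntidiagonal.antidiagonal n, f ij.1 * g ij.2) * h n := by
  rw [← ENNReal.tsum_prod, ← Finset.HasAntidiagonal.sigmaAntidiagonalEquivProd.tsum_eq, ENNReal.tsum_sigma']
  congr 1
  ext n
  rw [Finset.sum_mul, ← Finset.tsum_subtype]
  congr 1
  ext ij
  have := Finset.HasAntidiagonal.mem_antidiagonal.1 ij.2
  simp [Finset.HasAntidiagonal.sigmaAntidiagonalEquivProd, this]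

lemma heatSum_renewal {p : ℕ → ℝ} (hN : N ≠ 0) (hε : 0 < ε) (hq : ∀ k, 0 ≤ q k)
    (hs : Summable q) (hq0 : q 0 = 0) (hp : ∀ k, 0 ≤ p k) (hps : Summable p) (hp0 : p 0 = 0)
    (hren : ∀ n, q n = p n + ∑ ij ∈ Finset.HasAntidiagonal.antidiagonal n, q ij.1 * p ij.2)
    (x : Eucl N) :
    ENNReal.ofReal (heatSum N ε q x) = ENNReal.ofReal (heatSum N ε p x) +
      ∫⁻ y, ENNReal.ofReal (heatSum N ε q (x - y)) * ENNReal.ofReal (heatSum N ε p y) := by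
  have hm : ∀ (c : ENNReal) (k : ℕ), Measurable fun y : Eucl N =>
      c * ENNReal.ofReal (heatK N (k * ε) y) := fun c k =>
    ((continuous_heatK N _).measurable.ennreal_ofReal).const_mul _
  have hm' : ∀ (c : ENNReal) (k : ℕ), Measurable fun y : Eucl N =>
      c * ENNReal.ofReal (heatK N (k * ε) (x - y)) := fun c k =>
    (hm c k).comp (measurable_const.sub measurable_id)
  have h1 : ∫⁻ y, ENNReal.ofReal (heatSum N ε q (x - y)) * ENNReal.ofReal (heatSum N ε p y) =
      ∑' j, ∑' k, ENNReal.ofReal (q j) * ENNReal.ofReal (p k) *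
        ENNReal.ofReal (heatK N ((j + k : ℕ) * ε) x) := by
    simp_rw [ofReal_heatSum hN hε hq hs, ofReal_heatSum hN hε hp hps, ← ENNReal.tsum_mul_right]
    rw [lintegral_tsum fun j => Measurable.aemeasurable (by
      exact (hm' _ j).mul (Measurable.tsum fun k => hm _ k))]
    congr 1
    ext j
    simp_rw [← ENNReal.tsum_mul_left]
    rw [lintegral_tsum fun k => Measurable.aemeasurable (by exact (hm' _ j).mul (hm _ k))]
    congr 1
    ext k
    simp_rw [mul_mul_mul_comm]
    rw [lintegral_const_mul' _ _ (ENNReal.mul_ne_top ENNReal.ofReal_ne_top ENNReal.ofReal_ne_top)]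
    rcases Nat.eq_zero_or_pos j with rfl | hj
    · simp [hq0]
    rcases Nat.eq_zero_or_pos k with rfl | hk
    · simp [hp0]
    rw [lintegral_heatK_conv N (by positivity) (by positivity)]
    congr 3
    push_cast
    ring
  rw [h1, ENNReal_tsum_mul_tsum_antidiagonal (fun j => ENNReal.ofReal (q j))
    (fun k => ENNReal.ofReal (p k)) (fun n => ENNReal.ofReal (heatK N (n * ε) x)),
    ofReal_heatSum hN hε hp hps, ofReal_heatSum hN hε hq hs, ← ENNReal.tsum_add]
  congr 1
  ext n
  rw [← add_mul, hren n, ENNReal.ofReal_add (hp n)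
    (Finset.sum_nonneg fun ij _ => mul_nonneg (hq _) (hp _)),
    ENNReal.ofReal_sum_of_nonneg fun ij _ => mul_nonneg (hq _) (hp _)]
  simp_rw [ENNReal.ofReal_mul (hq _)]

end heatSum

lemma map_floor_volume_Ioi :
    (volume.restrict (Set.Ioi (0 : ℝ))).map (fun t : ℝ => ⌊t⌋₊) = Measure.count := by
  refine Measure.ext_of_singleton fun k => ?_
  rw [Measure.map_apply Nat.measurable_floor (measurableSet_singleton k),
    Measure.restrict_apply (Nat.measurable_floor (measurableSet_singleton k)),
    Measure.count_singleton]
  rcases eq_or_ne k 0 with rfl | hk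
  · have : (fun t : ℝ => ⌊t⌋₊) ⁻¹' {0} ∩ Set.Ioi 0 = Set.Ioo 0 1 := by
      ext t
      simp [and_comm]
    rw [this]; simp
  · rw [Nat.preimage_floor_of_ne_zero hk,
      Set.inter_eq_left.2]
    · simp
    · intro t ht
      have : (0 : ℝ) < k := by exact_mod_cast Nat.pos_of_ne_zero hk
      exact this.trans_le ht.1

lemma tsum_eq_integral_floor {c : ℕ → ℝ} (hc : Summable c) :
    ∑' k, c k = ∫ t in Set.Ioi (0 : ℝ), c ⌊t⌋₊ := by
  rw [← integral_map (μ := volume.restrict (Set.Ioi (0 : ℝ))) (φ := fun t : ℝ => ⌊t⌋₊) (f := c)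
    Nat.measurable_floor.aemeasurable (measurable_of_countable c).aestronglyMeasurable,
    map_floor_volume_Ioi, integral_countable]
  · simp
  · rw [integrable_count_iff]; exact hc.norm

lemma tsum_eq_integral_floor_mul {c : ℕ → ℝ} (hc : Summable c) {b : ℝ} (hb : 0 < b) :
    ∑' k, c k = b * ∫ s in Set.Ioi (0 : ℝ), c ⌊s * b⌋₊ := by
  rw [integral_comp_mul_right_Ioi (fun t => c ⌊t⌋₊) 0 hb, zero_mul,
    ← tsum_eq_integral_floor hc, smul_eq_mul, mul_inv_cancel_left₀ hb.ne']

lemma rpow_mul_exp_neg_div_eq {γ c s : ℝ} (hs : 0 < s) :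
    s ^ (-γ - 1) * exp (-c / s) =
      (|(-1 : ℝ)| * s ^ ((-1 : ℝ) - 1)) • ((s ^ (-1 : ℝ)) ^ (γ - 1) * exp (-(c * s ^ (-1 : ℝ)))) := by
  rw [← rpow_mul hs.le, abs_neg, abs_one, one_mul, smul_eq_mul, ← mul_assoc, ← rpow_add hs,
    rpow_neg_one, neg_div, div_eq_mul_inv]
  ring_nf

lemma integrableOn_rpow_mul_exp_neg_div {γ c : ℝ} (hγ : 0 < γ) (hc : 0 < c) :
    IntegrableOn (fun s => s ^ (-γ - 1) * exp (-c / s)) (Set.Ioi 0) := by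
  rw [integrableOn_congr_fun
    (g := fun s => (|(-1 : ℝ)| * s ^ ((-1 : ℝ) - 1)) •
      ((s ^ (-1 : ℝ)) ^ (γ - 1) * exp (-(c * s ^ (-1 : ℝ)))))
    (fun s (hs : s ∈ Set.Ioi (0 : ℝ)) => rpow_mul_exp_neg_div_eq (Set.mem_Ioi.1 hs))
    measurableSet_Ioi,
    integrableOn_Ioi_comp_rpow_iff (fun y => y ^ (γ - 1) * exp (-(c * y))) (by norm_num)]
  have := integrableOn_rpow_mul_exp_neg_mul_rpow (s := γ - 1) (p := 1) (b := c) (by linarith)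
    one_pos hc
  simpa using this

lemma integral_rpow_mul_exp_neg_div {γ c : ℝ} (hγ : 0 < γ) (hc : 0 < c) :
    ∫ s in Set.Ioi (0 : ℝ), s ^ (-γ - 1) * exp (-c / s) = Gamma γ * c ^ (-γ) := by
  rw [setIntegral_congr_fun measurableSet_Ioi (fun s hs => rpow_mul_exp_neg_div_eq hs),
    integral_comp_rpow_Ioi (fun y => y ^ (γ - 1) * exp (-(c * y))) (by norm_num),
    Real.integral_rpow_mul_exp_neg_mul_Ioi hγ hc, one_div, inv_rpow hc.le, rpow_neg hc.le, mul_comm]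

/-- The step function whose integral over `(0, ∞)` is the rescaled `heatSum`. -/
def heatStep (N : ℕ) (β : ℝ) (q : ℕ → ℝ) (r : ℝ) (n : ℕ) (x : Eucl N) (s : ℝ) : ℝ :=
  ((n : ℝ) + 1) ^ (1 - β) * (q ⌊s * (n + 1)⌋₊ * r ^ ⌊s * ((n : ℝ) + 1)⌋₊ *
    heatK N (⌊s * ((n : ℝ) + 1)⌋₊ * (1 / ((n : ℝ) + 1))) x)

section limit

variable {N : ℕ} {β : ℝ} {q : ℕ → ℝ}

lemma heatSum_eq_integral_heatStep (hN : N ≠ 0) (hq : ∀ k, 0 ≤ q k) {r : ℝ} (hr : 0 ≤ r)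
    (hs : Summable fun k => q k * r ^ k) (n : ℕ) (x : Eucl N) :
    ((n : ℝ) + 1) ^ (-β) * heatSum N (1 / ((n : ℝ) + 1)) (fun k => q k * r ^ k) x =
      ∫ s in Set.Ioi (0 : ℝ), heatStep N β q r n x s := by
  have hn : (0 : ℝ) < n + 1 := by positivity
  unfold heatStep
  rw [heatSum, tsum_eq_integral_floor_mul (summable_heatSum hN (by positivity)
    (fun k => by have := hq k; positivity) hs x) hn, integral_const_mul, ← mul_assoc]
  congr 1
  rw [sub_eq_neg_add, rpow_add hn, rpow_one]

lemma measurable_heatStep (r : ℝ) (n : ℕ) (x : Eucl N) : Measurable (heatStep N β q r n x) := by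
  have hf : Measurable fun s : ℝ => ⌊s * ((n : ℝ) + 1)⌋₊ :=
    Nat.measurable_floor.comp (measurable_id.mul_const _)
  exact (measurable_of_countable fun k : ℕ => ((n : ℝ) + 1) ^ (1 - β) * (q k * r ^ k *
    heatK N (k * (1 / ((n : ℝ) + 1))) x)).comp hf

/-- For a step with nonzero index, the scaled time `σ`. -/
lemma heatStep_eq {r s : ℝ} {n k : ℕ} (hk : ⌊s * ((n : ℝ) + 1)⌋₊ = k) (hk0 : k ≠ 0) (x : Eucl N) :
    heatStep N β q r n x s = ((k : ℝ) ^ (1 - β) * q k) * r ^ k *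
      (((k : ℝ) / (n + 1)) ^ (β - 1) * heatK N ((k : ℝ) / (n + 1)) x) := by
  have hkp : (0 : ℝ) < k := by exact_mod_cast Nat.pos_of_ne_zero hk0
  have hn : (0 : ℝ) < n + 1 := by positivity
  unfold heatStep
  rw [hk, mul_one_div, div_rpow hkp.le hn.le, show β - 1 = -(1 - β) by ring, rpow_neg hkp.le,
    rpow_neg hn.le]
  have := (rpow_pos_of_pos hkp (1 - β)).ne'
  have := (rpow_pos_of_pos hn (1 - β)).ne'
  field_simp

lemma heatStep_nonneg (hq : ∀ k, 0 ≤ q k) {r : ℝ} (hr : 0 ≤ r) (n : ℕ) (x : Eucl N) (s : ℝ) :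
    0 ≤ heatStep N β q r n x s := by
  unfold heatStep
  have := hq ⌊s * (n + 1)⌋₊
  have := heatK_nonneg N (s := ⌊s * ((n : ℝ) + 1)⌋₊ * (1 / ((n : ℝ) + 1))) (by positivity) x
  positivity

lemma heatStep_le (hN : N ≠ 0) (hβ : β < N / 2) {A : ℝ} (hA : ∀ k : ℕ, (k : ℝ) ^ (1 - β) * q k ≤ A)
    (hA0 : 0 ≤ A) {r : ℝ} (hr : 0 ≤ r) (hr1 : r ≤ 1) (n : ℕ) (x : Eucl N) {s : ℝ} (hs : 0 < s) :
    heatStep N β q r n x s ≤ A * π ^ (-((N : ℝ) / 2)) * 2 ^ ((N : ℝ) / 2 - β + 1) *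
      (s ^ (-((N : ℝ) / 2 - β) - 1) * exp (-‖x‖ ^ 2 / s)) := by
  have hn : (0 : ℝ) < n + 1 := by positivity
  obtain ⟨k, hk⟩ : ∃ k, ⌊s * ((n : ℝ) + 1)⌋₊ = k := ⟨_, rfl⟩
  rcases eq_or_ne k 0 with rfl | hk0
  · unfold heatStep
    rw [hk, Nat.cast_zero, zero_mul, heatK_zero hN, mul_zero, mul_zero]
    positivity
  · have hkp : (0 : ℝ) < k := by exact_mod_cast Nat.pos_of_ne_zero hk0
    have hk1 : (1 : ℝ) ≤ k := by exact_mod_cast Nat.one_le_iff_ne_zero.2 hk0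
    rw [heatStep_eq hk hk0]
    obtain ⟨h1, h2⟩ := (Nat.floor_eq_iff (by positivity)).1 hk
    set σ := (k : ℝ) / (n + 1) with hσ
    have hσ0 : 0 < σ := by positivity
    have hσs : σ ≤ s := by rw [hσ, div_le_iff₀ hn]; exact h1
    have hs2 : s / 2 ≤ σ := by rw [hσ, le_div_iff₀ hn]; linarith
    have e1 : σ ^ (β - 1) * heatK N σ x =
        π ^ (-((N : ℝ) / 2)) * (σ ^ (-((N : ℝ) / 2 - β) - 1) * exp (-‖x‖ ^ 2 / σ)) := by
      rw [heatK, mul_rpow pi_pos.le hσ0.le, show -((N : ℝ) / 2 - β) - 1 = (β - 1) + -((N : ℝ) / 2) by ring,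
        rpow_add hσ0]
      ring
    rw [e1]
    have e2 : exp (-‖x‖ ^ 2 / σ) ≤ exp (-‖x‖ ^ 2 / s) := by
      rw [exp_le_exp, neg_div, neg_div]
      have := div_le_div_of_nonneg_left (sq_nonneg ‖x‖) hσ0 hσs
      linarith
    have e3 : σ ^ (-((N : ℝ) / 2 - β) - 1) ≤ 2 ^ ((N : ℝ) / 2 - β + 1) * s ^ (-((N : ℝ) / 2 - β) - 1) := by
      calc σ ^ (-((N : ℝ) / 2 - β) - 1) ≤ (s / 2) ^ (-((N : ℝ) / 2 - β) - 1) :=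
            rpow_le_rpow_of_nonpos (by positivity) hs2 (by linarith)
        _ = _ := by
            rw [div_rpow hs.le (by norm_num), show (N : ℝ) / 2 - β + 1 = -(-((N : ℝ) / 2 - β) - 1) by ring,
              rpow_neg (by norm_num : (0 : ℝ) ≤ 2), div_eq_inv_mul]
    have e4 : (k : ℝ) ^ (1 - β) * q k * r ^ k ≤ A := by
      calc (k : ℝ) ^ (1 - β) * q k * r ^ k ≤ A * r ^ k := by gcongr; exact hA k
        _ ≤ A * 1 := by gcongr; exact pow_le_one₀ hr hr1
        _ = A := mul_one A
    calc _ ≤ A * (π ^ (-((N : ℝ) / 2)) * ((2 ^ ((N : ℝ) / 2 - β + 1) * s ^ (-((N : ℝ) / 2 - β) - 1)) *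
          exp (-‖x‖ ^ 2 / s))) := by gcongr
      _ = _ := by ring

lemma tendsto_heatStep {ℓ : ℝ} (hlim : Tendsto (fun k : ℕ => (k : ℝ) ^ (1 - β) * q k) atTop (𝓝 ℓ))
    {r : ℕ → ℝ} (hr : ∀ s : ℝ, 0 < s →
      Tendsto (fun n : ℕ => r n ^ ⌊s * ((n : ℝ) + 1)⌋₊) atTop (𝓝 1))
    (x : Eucl N) {s : ℝ} (hs : 0 < s) :
    Tendsto (fun n => heatStep N β q (r n) n x s) atTop
      (𝓝 (ℓ * π ^ (-((N : ℝ) / 2)) * (s ^ (-((N : ℝ) / 2 - β) - 1) * exp (-‖x‖ ^ 2 / s)))) := by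
  have hcast : Tendsto (fun n : ℕ => (n : ℝ) + 1) atTop atTop :=
    tendsto_atTop_add_const_right _ _ tendsto_natCast_atTop_atTop
  have hk : Tendsto (fun n : ℕ => ⌊s * ((n : ℝ) + 1)⌋₊) atTop atTop :=
    tendsto_nat_floor_atTop.comp (hcast.const_mul_atTop hs)
  have hσ : Tendsto (fun n : ℕ => (⌊s * ((n : ℝ) + 1)⌋₊ : ℝ) / ((n : ℝ) + 1)) atTop (𝓝 s) :=
    (tendsto_nat_floor_mul_div_atTop (R := ℝ) hs.le).comp hcast
  have hcont : ContinuousAt (fun σ : ℝ => σ ^ (β - 1) * heatK N σ x) s := by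
    unfold heatK
    have h1 : ContinuousAt (fun σ : ℝ => σ ^ (β - 1)) s := continuousAt_rpow_const _ _ (Or.inl hs.ne')
    have h2 : ContinuousAt (fun σ : ℝ => (π * σ) ^ (-((N : ℝ) / 2))) s :=
      (continuousAt_const.mul continuousAt_id).rpow_const (Or.inl (mul_pos pi_pos hs).ne')
    have h3 : ContinuousAt (fun σ : ℝ => exp (-‖x‖ ^ 2 / σ)) s :=
      (continuousAt_const.div continuousAt_id hs.ne').rexp
    exact h1.mul (h2.mul h3)
  have hmain := ((hlim.comp hk).mul (hr s hs)).mul (hcont.tendsto.comp hσ)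
  have hval : ℓ * 1 * (s ^ (β - 1) * heatK N s x) =
      ℓ * π ^ (-((N : ℝ) / 2)) * (s ^ (-((N : ℝ) / 2 - β) - 1) * exp (-‖x‖ ^ 2 / s)) := by
    rw [heatK, mul_rpow pi_pos.le hs.le, show -((N : ℝ) / 2 - β) - 1 = (β - 1) + -((N : ℝ) / 2) by ring,
      rpow_add hs]
    ring
  rw [hval] at hmain
  refine hmain.congr' ?_
  filter_upwards [hk.eventually_ne_atTop 0] with n hn
  exact (heatStep_eq rfl hn x).symm

theorem exists_heatSum_le (hN : N ≠ 0) (hβ : β < N / 2) (hq : ∀ k, 0 ≤ q k) {ℓ : ℝ}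
    (hlim : Tendsto (fun k : ℕ => (k : ℝ) ^ (1 - β) * q k) atTop (𝓝 ℓ))
    (hs : ∀ r : ℝ, 0 ≤ r → r < 1 → Summable fun k => q k * r ^ k) :
    ∃ C : ℝ, 0 ≤ C ∧ (∀ (n : ℕ) (r : ℝ), 0 ≤ r → r < 1 → ∀ x : Eucl N, x ≠ 0 →
      ((n : ℝ) + 1) ^ (-β) * heatSum N (1 / ((n : ℝ) + 1)) (fun k => q k * r ^ k) x ≤
        C * ‖x‖ ^ (2 * β - N)) ∧
    ∀ (r : ℕ → ℝ), (∀ n, 0 ≤ r n) → (∀ n, r n < 1) → (∀ s : ℝ, 0 < s →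
      Tendsto (fun n : ℕ => r n ^ ⌊s * ((n : ℝ) + 1)⌋₊) atTop (𝓝 1)) → ∀ x : Eucl N, x ≠ 0 →
      Tendsto (fun n : ℕ => ((n : ℝ) + 1) ^ (-β) *
        heatSum N (1 / ((n : ℝ) + 1)) (fun k => q k * r n ^ k) x) atTop
        (𝓝 (ℓ * π ^ (-((N : ℝ) / 2)) * Gamma ((N : ℝ) / 2 - β) * ‖x‖ ^ (2 * β - N))) := by
  obtain ⟨A, hA⟩ := hlim.bddAbove_range
  have hA' : ∀ k : ℕ, (k : ℝ) ^ (1 - β) * q k ≤ A := fun k => hA ⟨k, rfl⟩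
  have hA0 : 0 ≤ A := (mul_nonneg (by positivity) (hq 1)).trans (hA' 1)
  have hγ : 0 < (N : ℝ) / 2 - β := by linarith
  have hnorm : ∀ x : Eucl N, (‖x‖ ^ 2) ^ (-((N : ℝ) / 2 - β)) = ‖x‖ ^ (2 * β - N) := by
    intro x
    rw [← rpow_natCast, ← rpow_mul (norm_nonneg x)]
    congr 1
    push_cast
    ring
  have hG := Gamma_pos_of_pos hγ
  refine ⟨A * π ^ (-((N : ℝ) / 2)) * 2 ^ ((N : ℝ) / 2 - β + 1) * Gamma ((N : ℝ) / 2 - β),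
    by positivity, ?_, ?_⟩
  · intro n r hr hr1 x hx
    have hx2 : 0 < ‖x‖ ^ 2 := by have := norm_pos_iff.2 hx; positivity
    rw [heatSum_eq_integral_heatStep hN hq hr (hs r hr hr1), mul_assoc _ (Gamma _), ← hnorm,
      ← integral_rpow_mul_exp_neg_div hγ hx2, ← integral_const_mul]
    exact integral_mono_of_nonneg (ae_of_all _ (heatStep_nonneg hq hr n x))
      ((integrableOn_rpow_mul_exp_neg_div hγ hx2).const_mul _)
      (ae_restrict_of_forall_mem measurableSet_Ioi
        fun s hs => heatStep_le hN hβ hA' hA0 hr hr1.le n x hs)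
  · intro r hr hr1 hrl x hx
    have hx2 : 0 < ‖x‖ ^ 2 := by have := norm_pos_iff.2 hx; positivity
    rw [mul_assoc _ (Gamma _), ← hnorm, ← integral_rpow_mul_exp_neg_div hγ hx2,
      ← integral_const_mul]
    simp_rw [fun n => heatSum_eq_integral_heatStep (β := β) hN hq (hr n) (hs _ (hr n) (hr1 n)) n x]
    refine tendsto_integral_of_dominated_convergence _
      (fun n => (measurable_heatStep (r n) n x).aestronglyMeasurable)
      ((integrableOn_rpow_mul_exp_neg_div hγ hx2).const_mul
        (A * π ^ (-((N : ℝ) / 2)) * 2 ^ ((N : ℝ) / 2 - β + 1))) ?_ ?_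
    · intro n
      refine ae_restrict_of_forall_mem measurableSet_Ioi fun s hs => ?_
      rw [norm_of_nonneg (heatStep_nonneg hq (hr n) n x s)]
      exact heatStep_le hN hβ hA' hA0 (hr n) (hr1 n).le n x hs
    · exact ae_restrict_of_forall_mem measurableSet_Ioi fun s hs => tendsto_heatStep hlim hrl x hs

end limit

lemma tendsto_one_sub_inv_sq_pow_floor {s : ℝ} (hs : 0 < s) :
    Tendsto (fun n : ℕ => (1 - 1 / ((n : ℝ) + 1) ^ 2) ^ ⌊s * ((n : ℝ) + 1)⌋₊) atTop (𝓝 1) := by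
  have hle : ∀ n : ℕ, 1 / ((n : ℝ) + 1) ^ 2 ≤ 1 := fun n => by
    rw [div_le_one (by positivity)]
    have : (1 : ℝ) ≤ (n : ℝ) + 1 := by linarith [(Nat.cast_nonneg n : (0 : ℝ) ≤ n)]
    exact one_le_pow₀ this
  have hlow : Tendsto (fun n : ℕ => 1 - s * (1 / ((n : ℝ) + 1))) atTop (𝓝 1) := by
    have := (tendsto_one_div_add_atTop_nhds_zero_nat (𝕜 := ℝ)).const_mul s
    simpa using this.const_sub 1
  refine tendsto_of_tendsto_of_tendsto_of_le_of_le hlow tendsto_const_nhds (fun n => ?_)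
    fun n => pow_le_one₀ (by linarith [hle n]) (by
      have : 0 ≤ 1 / ((n : ℝ) + 1) ^ 2 := by positivity
      linarith)
  have hn : (0 : ℝ) < n + 1 := by positivity
  have h1 := one_add_mul_le_pow (a := -(1 / ((n : ℝ) + 1) ^ 2)) (by linarith [hle n])
    ⌊s * ((n : ℝ) + 1)⌋₊
  rw [← sub_eq_add_neg] at h1
  refine le_trans ?_ h1
  have h2 : (⌊s * ((n : ℝ) + 1)⌋₊ : ℝ) ≤ s * (n + 1) := Nat.floor_le (by positivity)
  have h3 : (⌊s * ((n : ℝ) + 1)⌋₊ : ℝ) * (1 / ((n : ℝ) + 1) ^ 2) ≤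
      s * (n + 1) * (1 / ((n : ℝ) + 1) ^ 2) := by gcongr
  have h4 : s * ((n : ℝ) + 1) * (1 / ((n : ℝ) + 1) ^ 2) = s * (1 / ((n : ℝ) + 1)) := by
    field_simp
  linarith

/-- A sequence of jump kernels `p` whose rescalings approximate the kernel of the fractional
Laplacian, together with the associated Green kernels `v`, approximating the Riesz potential. -/
structure JumpApprox (N : ℕ) (α : ℝ) (C D D' : ℝ) (p v : ℕ → Eucl N → ℝ) (m : ℕ → ℝ) : Prop where
  C_nonneg : 0 ≤ C
  D_nonneg : 0 ≤ D
  D'_pos : 0 < D'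
  p_nonneg : ∀ n x, 0 ≤ p n x
  v_nonneg : ∀ n x, 0 ≤ v n x
  p_neg : ∀ n x, p n (-x) = p n x
  p_meas : ∀ n, Measurable (p n)
  v_meas : ∀ n, Measurable (v n)
  p_int : ∀ n, Integrable (p n)
  v_int : ∀ n, Integrable (v n)
  integral_p : ∀ n, ∫ x, p n x = m n
  m_nonneg : ∀ n, 0 ≤ m n
  m_le : ∀ n, m n ≤ 1
  m_lim : Tendsto (fun n : ℕ => ((n : ℝ) + 1) ^ (α / 2) * (1 - m n)) atTop (𝓝 0)
  renewal : ∀ n x, ENNReal.ofReal (v n x) = ENNReal.ofReal (p n x) +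
      ∫⁻ y, ENNReal.ofReal (v n (x - y)) * ENNReal.ofReal (p n y)
  v_le : ∀ (n : ℕ) (x : Eucl N), x ≠ 0 →
    ((n : ℝ) + 1) ^ (-(α / 2)) * v n x ≤ C * ‖x‖ ^ (α - N)
  v_lim : ∀ x : Eucl N, x ≠ 0 →
    Tendsto (fun n : ℕ => ((n : ℝ) + 1) ^ (-(α / 2)) * v n x) atTop (𝓝 (D * ‖x‖ ^ (α - N)))
  p_le : ∀ (n : ℕ) (x : Eucl N), x ≠ 0 →
    ((n : ℝ) + 1) ^ (α / 2) * p n x ≤ C * ‖x‖ ^ (-((N : ℝ) + α))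
  p_lim : ∀ x : Eucl N, x ≠ 0 →
    Tendsto (fun n : ℕ => ((n : ℝ) + 1) ^ (α / 2) * p n x) atTop
      (𝓝 (D' * ‖x‖ ^ (-((N : ℝ) + α))))

lemma potCoeff_zero (a : ℝ) : potCoeff a 0 = 0 := by simp [potCoeff]

lemma jumpCoeff_zero (a : ℝ) : jumpCoeff a 0 = 0 := by simp [jumpCoeff]

theorem exists_jumpApprox {N : ℕ} (hN : 3 ≤ N) {α : ℝ} (hα1 : 0 < α) (hα2 : α < 2) :
    ∃ C D D' p v m, JumpApprox N α C D D' p v m := by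
  have hN0 : N ≠ 0 := by omega
  have hN3 : (3 : ℝ) ≤ N := by exact_mod_cast hN
  set a := α / 2 with ha_def
  have ha : 0 < a := by positivity
  have ha1 : a < 1 := by rw [ha_def]; linarith
  obtain ⟨C₁, hC₁, hv1, hv2⟩ := exists_heatSum_le (N := N) (β := a) hN0 (by linarith)
    (potCoeff_nonneg ha) (tendsto_potCoeff ha) (fun r => summable_potCoeff a)
  obtain ⟨C₂, hC₂, hp1, hp2⟩ := exists_heatSum_le (N := N) (β := -a) hN0 (by linarith)
    (jumpCoeff_nonneg ha ha1) (tendsto_jumpCoeff ha ha1)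
    (fun r h0 h1 => (hasSum_jumpCoeff a h0 h1).summable)
  set r : ℕ → ℝ := fun n => 1 - 1 / ((n : ℝ) + 1) ^ 2 with hr
  have hr0 : ∀ n, 0 ≤ r n := fun n => by
    have : 1 / ((n : ℝ) + 1) ^ 2 ≤ 1 := by
      rw [div_le_one (by positivity)]
      have : (1 : ℝ) ≤ (n : ℝ) + 1 := by linarith [(Nat.cast_nonneg n : (0 : ℝ) ≤ n)]
      exact one_le_pow₀ this
    simp only [hr]; linarith
  have hr1 : ∀ n, r n < 1 := fun n => by
    have : 0 < 1 / ((n : ℝ) + 1) ^ 2 := by positivity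
    simp only [hr]; linarith
  have hε : ∀ n : ℕ, 0 < 1 / ((n : ℝ) + 1) := fun n => by positivity
  have hj : ∀ n k, 0 ≤ jumpCoeff a k * r n ^ k := fun n k =>
    mul_nonneg (jumpCoeff_nonneg ha ha1 k) (pow_nonneg (hr0 n) k)
  have hq : ∀ n k, 0 ≤ potCoeff a k * r n ^ k := fun n k =>
    mul_nonneg (potCoeff_nonneg ha k) (pow_nonneg (hr0 n) k)
  have hjs : ∀ n, HasSum (fun k => jumpCoeff a k * r n ^ k) (1 - (1 - r n) ^ a) := fun n =>
    hasSum_jumpCoeff a (hr0 n) (hr1 n)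
  have hqs : ∀ n, Summable (fun k => potCoeff a k * r n ^ k) := fun n =>
    summable_potCoeff a (hr0 n) (hr1 n)
  have hj0 : ∀ n, jumpCoeff a 0 * r n ^ 0 = 0 := fun n => by rw [jumpCoeff_zero, zero_mul]
  have hq0 : ∀ n, potCoeff a 0 * r n ^ 0 = 0 := fun n => by rw [potCoeff_zero, zero_mul]
  have hren : ∀ n k, potCoeff a k * r n ^ k = jumpCoeff a k * r n ^ k +
      ∑ ij ∈ Finset.HasAntidiagonal.antidiagonal k,
        (potCoeff a ij.1 * r n ^ ij.1) * (jumpCoeff a ij.2 * r n ^ ij.2) := fun n k => by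
    conv_lhs => rw [potCoeff_renewal, add_mul, Finset.sum_mul]
    congr 1
    refine Finset.sum_congr rfl fun ij hij => ?_
    rw [← Finset.HasAntidiagonal.mem_antidiagonal.1 hij, pow_add]
    ring
  have hG := Gamma_pos_of_pos ha
  have hG' := Gamma_neg_lt_zero ha ha1
  refine ⟨max C₁ C₂, (Gamma a)⁻¹ * π ^ (-((N : ℝ) / 2)) * Gamma ((N : ℝ) / 2 - a),
    -(Gamma (-a))⁻¹ * π ^ (-((N : ℝ) / 2)) * Gamma ((N : ℝ) / 2 - -a),
    fun n => heatSum N (1 / ((n : ℝ) + 1)) fun k => jumpCoeff a k * r n ^ k,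
    fun n => heatSum N (1 / ((n : ℝ) + 1)) fun k => potCoeff a k * r n ^ k,
    fun n => 1 - (1 - r n) ^ a, ?_⟩
  have e1 : 2 * a - N = α - N := by rw [ha_def]; ring
  have e2 : 2 * -a - N = -((N : ℝ) + α) := by rw [ha_def]; ring
  rw [e1] at hv1 hv2
  rw [e2] at hp1 hp2
  rw [neg_neg] at hp1 hp2
  have hm : ∀ n, (1 - r n) ^ a = (((n : ℝ) + 1) ^ a)⁻¹ * (((n : ℝ) + 1) ^ a)⁻¹ := fun n => by
    simp only [hr]
    rw [sub_sub_cancel, one_div, inv_rpow (by positivity), ← mul_inv, ← mul_rpow (by positivity)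
      (by positivity), sq]
  refine
    { C_nonneg := le_max_of_le_left hC₁
      D_nonneg := ?_
      D'_pos := ?_
      p_nonneg := fun n x => heatSum_nonneg (hε n) (hj n) x
      v_nonneg := fun n x => heatSum_nonneg (hε n) (hq n) x
      p_neg := fun n x => heatSum_neg x
      p_meas := fun n => measurable_heatSum hN0 (hε n) (hj n) (hjs n).summable
      v_meas := fun n => measurable_heatSum hN0 (hε n) (hq n) (hqs n)
      p_int := fun n => integrable_heatSum hN0 (hε n) (hj n) (hjs n).summable (hj0 n)
      v_int := fun n => integrable_heatSum hN0 (hε n) (hq n) (hqs n) (hq0 n)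
      integral_p := fun n => by
        rw [integral_heatSum hN0 (hε n) (hj n) (hjs n).summable (hj0 n), (hjs n).tsum_eq]
      m_nonneg := fun n => (hjs n).nonneg (hj n)
      m_le := fun n => by
        have : 0 ≤ (1 - r n) ^ a := rpow_nonneg (by linarith [hr1 n]) a
        linarith
      m_lim := ?_
      renewal := fun n x => heatSum_renewal hN0 (hε n) (hq n) (hqs n) (hq0 n) (hj n)
        (hjs n).summable (hj0 n) (hren n) x
      v_le := fun n x hx => (hv1 n (r n) (hr0 n) (hr1 n) x hx).trans
        (mul_le_mul_of_nonneg_right (le_max_left _ _) (by positivity))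
      v_lim := fun x hx => hv2 r hr0 hr1 (fun s hs => tendsto_one_sub_inv_sq_pow_floor hs) x hx
      p_le := fun n x hx => (hp1 n (r n) (hr0 n) (hr1 n) x hx).trans
        (mul_le_mul_of_nonneg_right (le_max_right _ _) (by positivity))
      p_lim := fun x hx => hp2 r hr0 hr1 (fun s hs => tendsto_one_sub_inv_sq_pow_floor hs) x hx }
  · have := Gamma_pos_of_pos (show 0 < (N : ℝ) / 2 - a by linarith)
    positivity
  · have h1 := Gamma_pos_of_pos (show 0 < (N : ℝ) / 2 - -a by linarith)
    have h2 : 0 < -(Gamma (-a))⁻¹ := by rw [← inv_neg]; exact inv_pos.2 (by linarith)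
    positivity
  · have h : ∀ n : ℕ, ((n : ℝ) + 1) ^ a * (1 - (1 - (1 - r n) ^ a)) = ((n : ℝ) + 1) ^ (-a) := by
      intro n
      have hpos : (0 : ℝ) < ((n : ℝ) + 1) ^ a := by positivity
      rw [sub_sub_cancel, hm, mul_inv_cancel_left₀ hpos.ne', rpow_neg (by positivity)]
    refine Tendsto.congr (fun n => (h n).symm) ?_
    exact (tendsto_rpow_neg_atTop ha).comp
      (tendsto_atTop_add_const_right _ _ tendsto_natCast_atTop_atTop)

/-- The Riesz kernel `‖x‖^{α-N}`, without its normalising constant. -/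
def rieszK (N : ℕ) (α : ℝ) (x : Eucl N) : ℝ := ‖x‖ ^ (α - N)

section riesz

variable {N : ℕ} {α : ℝ}

lemma rieszK_nonneg (x : Eucl N) : 0 ≤ rieszK N α x := rpow_nonneg (norm_nonneg x) _

lemma measurable_rieszK : Measurable (rieszK N α) := by unfold rieszK; fun_prop

lemma locallyIntegrable_rieszK (hN : 3 ≤ N) (hα : 0 < α) : LocallyIntegrable (rieszK N α) := by
  refine locallyIntegrable_of_norm_le_rpow (C := 1) (α := N - α) ?_ ?_ (ae_of_all _ fun x => ?_)
    measurable_rieszK.aestronglyMeasurable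
  · rw [finrank_euclideanSpace_fin]; omega
  · rw [finrank_euclideanSpace_fin]; linarith
  · rw [norm_of_nonneg (rieszK_nonneg x), one_mul, neg_sub, rieszK]

lemma integrableOn_rieszK_ball (hN : 3 ≤ N) (hα : 0 < α) (R : ℝ) :
    IntegrableOn (rieszK N α) (Metric.ball 0 R) :=
  ((locallyIntegrable_rieszK hN hα).integrableOn_isCompact
    (isCompact_closedBall 0 R)).mono_set Metric.ball_subset_closedBall

theorem integrable_mul_rieszK (hN : 3 ≤ N) (hα1 : 0 < α)
    {ρ : Eucl N → ℝ} (hρm : Measurable ρ) (hρnn : ∀ x, 0 ≤ ρ x)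
    (hρlb : ∀ R : ℝ, ∃ M : ℝ, ∀ x : Eucl N, ‖x‖ ≤ R → ρ x ≤ M) {ρstar : ℝ → ℝ}
    (hρstar : ∀ r : ℝ, ρstar r = sSup (ρ '' {x : Eucl N | ‖x‖ = r})) {η : ℝ}
    (hint : IntegrableOn (fun r : ℝ => r ^ (α - 1) * ρstar r) (Set.Ioi η)) :
    Integrable fun y => ρ y * rieszK N α y := by
  obtain ⟨M, hM⟩ := hρlb (η + 1)
  have hstar0 : ∀ r, 0 ≤ ρstar r := fun r => by
    rw [hρstar]
    exact Real.sSup_nonneg (by rintro _ ⟨x, -, rfl⟩; exact hρnn x)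
  have hle : ∀ y, ρ y ≤ ρstar ‖y‖ := fun y => by
    rw [hρstar]
    obtain ⟨M', hM'⟩ := hρlb ‖y‖
    exact le_csSup ⟨M', by rintro _ ⟨x, hx, rfl⟩; exact hM' x (le_of_eq hx)⟩ ⟨y, rfl, rfl⟩
  have h1 : Integrable ((Metric.ball (0 : Eucl N) (η + 1)).indicator
      fun y => M * rieszK N α y) :=
    IntegrableOn.integrable_indicator ((integrableOn_rieszK_ball hN hα1 (η + 1)).const_mul M)
      Metric.isOpen_ball.measurableSet
  have h2 : Integrable fun y : Eucl N =>
      (Set.Ioi η).indicator (fun r => ρstar r * r ^ (α - N)) ‖y‖ := by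
    have : Nontrivial (Eucl N) := by
      refine Module.nontrivial_of_finrank_pos (R := ℝ) ?_
      rw [finrank_euclideanSpace_fin]; omega
    rw [integrable_fun_norm_addHaar volume
      (f := (Set.Ioi η).indicator (fun r => ρstar r * r ^ (α - N)))]
    refine IntegrableOn.congr_fun ((hint.integrable_indicator measurableSet_Ioi).integrableOn)
      (fun r hr => ?_) measurableSet_Ioi
    have hr0 : (0 : ℝ) < r := hr
    by_cases h : r ∈ Set.Ioi η
    · simp only [Set.indicator_of_mem h, finrank_euclideanSpace_fin, smul_eq_mul]
      have : r ^ (N - 1) * r ^ (α - N) = r ^ (α - 1) := by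
        rw [← rpow_natCast, ← rpow_add hr0, Nat.cast_sub (by omega)]
        congr 1
        push_cast; ring
      rw [← this]; ring
    · simp only [Set.indicator_of_notMem h, smul_zero]
  refine (h1.add h2).mono' (hρm.mul measurable_rieszK).aestronglyMeasurable
    (ae_of_all _ fun y => ?_)
  rw [norm_of_nonneg (mul_nonneg (hρnn y) (rieszK_nonneg y)), Pi.add_apply]
  have hnn2 : 0 ≤ (Set.Ioi η).indicator (fun r => ρstar r * r ^ (α - N)) ‖y‖ :=
    Set.indicator_apply_nonneg fun _ => mul_nonneg (hstar0 _) (by positivity)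
  by_cases hy : y ∈ Metric.ball (0 : Eucl N) (η + 1)
  · rw [Set.indicator_of_mem hy]
    have := mul_le_mul_of_nonneg_right (hM y (mem_ball_zero_iff.1 hy).le)
      (rieszK_nonneg (α := α) y)
    linarith
  · rw [Set.indicator_of_notMem hy, Set.indicator_of_mem, zero_add]
    · exact mul_le_mul_of_nonneg_right (hle y) (rieszK_nonneg y)
    · rw [mem_ball_zero_iff, not_lt] at hy
      rw [Set.mem_Ioi]; linarith

/-- The Riesz kernel truncated at distance `δ`. -/
def rieszTrunc (N : ℕ) (α δ : ℝ) (x : Eucl N) : ℝ := max ‖x‖ δ ^ (α - N)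

lemma rieszTrunc_nonneg (δ : ℝ) (x : Eucl N) : 0 ≤ rieszTrunc N α δ x :=
  rpow_nonneg (le_max_of_le_left (norm_nonneg x)) _

lemma continuous_rieszTrunc {δ : ℝ} (hδ : 0 < δ) : Continuous (rieszTrunc N α δ) :=
  (continuous_norm.max continuous_const).rpow_const
    fun _ => Or.inl (lt_max_of_lt_right hδ).ne'

lemma abs_rieszK_sub_rieszTrunc_le (hαN : α < N) {δ : ℝ} {x : Eucl N} (hx : x ≠ 0) :
    |rieszK N α x - rieszTrunc N α δ x| ≤ (Metric.ball 0 δ).indicator (rieszK N α) x := by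
  have hx0 := norm_pos_iff.2 hx
  by_cases h : x ∈ Metric.ball (0 : Eucl N) δ
  · rw [Set.indicator_of_mem h]
    have h1 : rieszTrunc N α δ x ≤ rieszK N α x :=
      rpow_le_rpow_of_nonpos hx0 (le_max_left _ _) (by linarith)
    rw [abs_of_nonneg (by linarith)]
    linarith [rieszTrunc_nonneg (α := α) δ x]
  · rw [Set.indicator_of_notMem h]
    rw [mem_ball_zero_iff, not_lt] at h
    rw [rieszTrunc, max_eq_left h, rieszK, sub_self, abs_zero]

/-- A nonnegative, measurable, locally bounded weight integrable against the Riesz kernel. -/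
structure RieszWeight (N : ℕ) (α : ℝ) (g : Eucl N → ℝ) : Prop where
  meas : Measurable g
  nonneg : ∀ x, 0 ≤ g x
  bdd : ∀ R : ℝ, ∃ M : ℝ, ∀ x : Eucl N, ‖x‖ ≤ R → g x ≤ M
  int : Integrable fun y => g y * rieszK N α y

variable {g : Eucl N → ℝ}

lemma RieszWeight.exists_bound_trunc (hg : RieszWeight N α g) (hαN : α < N) {δ : ℝ}
    (hδ : 0 < δ) {R : ℝ} (hR : 0 < R) :
    ∃ B : Eucl N → ℝ, Integrable B ∧ (∀ y, 0 ≤ B y) ∧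
      ∀ x, ‖x‖ ≤ R → ∀ y, rieszTrunc N α δ (x - y) * g y ≤ B y := by
  obtain ⟨M, hM⟩ := hg.bdd (2 * R)
  have hM0 : 0 ≤ M := (hg.nonneg 0).trans (hM 0 (by simp; positivity))
  refine ⟨fun y => (Metric.closedBall (0 : Eucl N) (2 * R)).indicator (fun _ => δ ^ (α - N) * M) y +
    (1 / 2 : ℝ) ^ (α - N) * (g y * rieszK N α y), ?_, ?_, ?_⟩
  · refine Integrable.add ?_ (hg.int.const_mul _)
    refine IntegrableOn.integrable_indicator ?_ measurableSet_closedBall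
    exact integrableOn_const measure_closedBall_lt_top.ne
  · intro y
    have h1 := mul_nonneg (hg.nonneg y) (rieszK_nonneg (α := α) y)
    have h2 : 0 ≤ (Metric.closedBall (0 : Eucl N) (2 * R)).indicator
      (fun _ => δ ^ (α - N) * M) y := Set.indicator_apply_nonneg fun _ => by positivity
    positivity
  · intro x hx y
    beta_reduce
    have h1 := mul_nonneg (hg.nonneg y) (rieszK_nonneg (α := α) y)
    by_cases hy : y ∈ Metric.closedBall (0 : Eucl N) (2 * R)
    · rw [Set.indicator_of_mem hy]
      have h2 : rieszTrunc N α δ (x - y) ≤ δ ^ (α - N) :=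
        rpow_le_rpow_of_nonpos hδ (le_max_right _ _) (by linarith)
      have h3 := hM y (mem_closedBall_zero_iff.1 hy)
      have h4 : rieszTrunc N α δ (x - y) * g y ≤ δ ^ (α - N) * M :=
        mul_le_mul h2 h3 (hg.nonneg y) (by positivity)
      have h5 : 0 ≤ (1 / 2 : ℝ) ^ (α - N) * (g y * rieszK N α y) := by positivity
      linarith
    · rw [Set.indicator_of_notMem hy, zero_add]
      rw [mem_closedBall_zero_iff, not_le] at hy
      have hy0 : 0 < ‖y‖ := by linarith
      have h2 : 1 / 2 * ‖y‖ ≤ max ‖x - y‖ δ := by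
        refine le_max_of_le_left ?_
        have := norm_sub_norm_le y x
        rw [norm_sub_rev] at this
        linarith
      have h3 : rieszTrunc N α δ (x - y) ≤ (1 / 2 * ‖y‖) ^ (α - N) :=
        rpow_le_rpow_of_nonpos (by positivity) h2 (by linarith)
      rw [mul_rpow (by norm_num) hy0.le] at h3
      calc _ ≤ ((1 / 2 : ℝ) ^ (α - N) * ‖y‖ ^ (α - N)) * g y :=
            mul_le_mul_of_nonneg_right h3 (hg.nonneg y)
        _ = _ := by rw [rieszK]; ring

lemma indicator_rieszK_mul_le {R : ℝ} {G : ℝ}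
    (hG : ∀ y : Eucl N, ‖y‖ ≤ R + 1 → g y ≤ G) {δ : ℝ} (hδ : δ ≤ 1) {x : Eucl N} (hx : ‖x‖ ≤ R)
    (y : Eucl N) : (Metric.ball 0 δ).indicator (rieszK N α) (x - y) * g y ≤
      G * (Metric.ball 0 δ).indicator (rieszK N α) (x - y) := by
  by_cases h : x - y ∈ Metric.ball (0 : Eucl N) δ
  · rw [Set.indicator_of_mem h, mul_comm]
    refine mul_le_mul_of_nonneg_right (hG y ?_) (rieszK_nonneg _)
    rw [mem_ball_zero_iff] at h
    have := norm_sub_norm_le y x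
    rw [norm_sub_rev] at this
    linarith
  · rw [Set.indicator_of_notMem h]; simp

lemma integrable_indicator_rieszK_sub (hN : 3 ≤ N) (hα : 0 < α) (δ : ℝ) (x : Eucl N) :
    Integrable fun y => (Metric.ball 0 δ).indicator (rieszK N α) (x - y) :=
  ((integrableOn_rieszK_ball hN hα δ).integrable_indicator
    Metric.isOpen_ball.measurableSet).comp_sub_left x

lemma ae_sub_ne_zero (hN : 3 ≤ N) (x : Eucl N) : ∀ᵐ y : Eucl N, x - y ≠ 0 := by
  have : Nontrivial (Eucl N) := by
    refine Module.nontrivial_of_finrank_pos (R := ℝ) ?_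
    rw [finrank_euclideanSpace_fin]; omega
  have h : ∀ᵐ y : Eucl N, y ≠ x := by
    rw [ae_iff]; simp
  filter_upwards [h] with y hy
  exact sub_ne_zero.2 hy.symm

lemma measurable_rieszK_sub (x : Eucl N) : Measurable fun y => rieszK N α (x - y) :=
  measurable_rieszK.comp (measurable_const.sub measurable_id)

theorem RieszWeight.integrable_sub (hg : RieszWeight N α g) (hN : 3 ≤ N) (hα : 0 < α)
    (hα2 : α < 2) (x : Eucl N) : Integrable fun y => rieszK N α (x - y) * g y := by
  have hαN : α < N := by
    have : (3 : ℝ) ≤ N := by exact_mod_cast hN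
    linarith
  obtain ⟨B, hB, hB0, hBle⟩ := hg.exists_bound_trunc hαN one_pos (R := ‖x‖ + 1) (by positivity)
  obtain ⟨G, hG⟩ := hg.bdd (‖x‖ + 1 + 1)
  refine (((integrable_indicator_rieszK_sub hN hα 1 x).const_mul G).add hB).mono'
    ((measurable_rieszK_sub x).mul hg.meas).aestronglyMeasurable ?_
  filter_upwards [ae_sub_ne_zero hN x] with y hy
  have hxR : ‖x‖ ≤ ‖x‖ + 1 := by linarith
  have h1 := indicator_rieszK_mul_le (α := α) hG le_rfl hxR y
  have h2 := hBle x hxR y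
  have h3 := abs_le.1 (abs_rieszK_sub_rieszTrunc_le (δ := 1) hαN hy)
  have h4 := mul_le_mul_of_nonneg_right h3.2 (hg.nonneg y)
  rw [norm_of_nonneg (mul_nonneg (rieszK_nonneg _) (hg.nonneg y)), Pi.add_apply]
  linarith

lemma exists_integral_indicator_lt (hN : 3 ≤ N) (hα : 0 < α) {ε : ℝ} (hε : 0 < ε) :
    ∃ δ : ℝ, 0 < δ ∧ δ ≤ 1 ∧ ∫ y, (Metric.ball (0 : Eucl N) δ).indicator (rieszK N α) y < ε := by
  have hlim : Tendsto (fun n : ℕ => ∫ y, (Metric.ball (0 : Eucl N) (1 / ((n : ℝ) + 1))).indicator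
      (rieszK N α) y) atTop (𝓝 (∫ _y : Eucl N, (0 : ℝ))) := by
    refine tendsto_integral_of_dominated_convergence
      ((Metric.ball (0 : Eucl N) 1).indicator (rieszK N α))
      (fun n => (measurable_rieszK.indicator Metric.isOpen_ball.measurableSet).aestronglyMeasurable)
      ((integrableOn_rieszK_ball hN hα 1).integrable_indicator Metric.isOpen_ball.measurableSet)
      (fun n => ae_of_all _ fun y => ?_) ?_
    · rw [norm_of_nonneg (Set.indicator_apply_nonneg fun _ => rieszK_nonneg y)]
      refine Set.indicator_le_indicator_of_subset (Metric.ball_subset_ball ?_)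
        (fun _ => rieszK_nonneg _) y
      rw [div_le_one (by positivity)]
      linarith [(Nat.cast_nonneg n : (0 : ℝ) ≤ n)]
    · filter_upwards [ae_sub_ne_zero hN 0] with y hy
      have hy0 : 0 < ‖y‖ := by simpa using hy
      refine tendsto_const_nhds.congr' ?_
      filter_upwards [(tendsto_one_div_add_atTop_nhds_zero_nat (𝕜 := ℝ)).eventually
        (gt_mem_nhds hy0)] with n hn
      rw [Set.indicator_of_notMem]
      rw [mem_ball_zero_iff, not_lt]
      exact hn.le
  rw [integral_zero] at hlim
  obtain ⟨n, hn⟩ := (hlim.eventually (gt_mem_nhds hε)).exists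
  refine ⟨1 / ((n : ℝ) + 1), by positivity, ?_, hn⟩
  rw [div_le_one (by positivity)]
  linarith [(Nat.cast_nonneg n : (0 : ℝ) ≤ n)]

theorem RieszWeight.tendsto_integral_abs_sub (hg : RieszWeight N α g) (hN : 3 ≤ N) (hα : 0 < α)
    (hα2 : α < 2) (x : Eucl N) :
    Tendsto (fun x' => ∫ y, |rieszK N α (x' - y) - rieszK N α (x - y)| * g y) (𝓝 x) (𝓝 0) := by
  have hαN : α < N := by
    have : (3 : ℝ) ≤ N := by exact_mod_cast hN
    linarith
  set R := ‖x‖ + 1 with hR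
  obtain ⟨G, hG⟩ := hg.bdd (R + 1)
  have hG0 : 0 ≤ G := (hg.nonneg 0).trans (hG 0 (by rw [norm_zero]; positivity))
  rw [Metric.tendsto_nhds]
  intro ε hε
  obtain ⟨δ, hδ0, hδ1, hδ⟩ := exists_integral_indicator_lt (N := N) hN hα
    (show 0 < ε / (4 * (G + 1)) by positivity)
  obtain ⟨B, hB, hB0, hBle⟩ := hg.exists_bound_trunc hαN hδ0 (R := R) (by positivity)
  have hxR : ‖x‖ ≤ R := by linarith
  have hnear : ∀ᶠ x' in 𝓝 x, ‖x'‖ ≤ R := by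
    filter_upwards [Metric.ball_mem_nhds x one_pos] with x' hx'
    have := norm_sub_norm_le x' x
    rw [mem_ball_iff_norm] at hx'
    linarith
  have hmeasT : ∀ x' : Eucl N, AEStronglyMeasurable
      (fun y => |rieszTrunc N α δ (x' - y) - rieszTrunc N α δ (x - y)| * g y) volume := by
    intro x'
    have h1 : ∀ z : Eucl N, Measurable fun y => rieszTrunc N α δ (z - y) := fun z =>
      (continuous_rieszTrunc hδ0).measurable.comp (measurable_const.sub measurable_id)
    exact (((h1 x').sub (h1 x)).norm.mul hg.meas).aestronglyMeasurable
  have hbd : ∀ x' : Eucl N, ‖x'‖ ≤ R → ∀ y,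
      ‖|rieszTrunc N α δ (x' - y) - rieszTrunc N α δ (x - y)| * g y‖ ≤ 2 * B y := by
    intro x' hx' y
    rw [norm_mul, norm_of_nonneg (abs_nonneg _), norm_of_nonneg (hg.nonneg y)]
    have h1 := hBle x' hx' y
    have h2 := hBle x hxR y
    have h3 : |rieszTrunc N α δ (x' - y) - rieszTrunc N α δ (x - y)| ≤
        rieszTrunc N α δ (x' - y) + rieszTrunc N α δ (x - y) := by
      have := rieszTrunc_nonneg (α := α) δ (x' - y)
      have := rieszTrunc_nonneg (α := α) δ (x - y)
      rw [abs_le]; constructor <;> linarith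
    have := mul_le_mul_of_nonneg_right h3 (hg.nonneg y)
    linarith
  have htr : Tendsto (fun x' => ∫ y, |rieszTrunc N α δ (x' - y) - rieszTrunc N α δ (x - y)| * g y)
      (𝓝 x) (𝓝 (∫ _y : Eucl N, (0 : ℝ))) := by
    refine tendsto_integral_filter_of_dominated_convergence (fun y => 2 * B y)
      (Eventually.of_forall hmeasT) ?_ (hB.const_mul 2) (ae_of_all _ fun y => ?_)
    · filter_upwards [hnear] with x' hx'
      exact ae_of_all _ (hbd x' hx')
    · have hc : Continuous fun x' : Eucl N =>
          |rieszTrunc N α δ (x' - y) - rieszTrunc N α δ (x - y)| * g y := by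
        have := continuous_rieszTrunc (N := N) (α := α) hδ0
        fun_prop
      have := hc.tendsto x
      simpa using this
  rw [integral_zero] at htr
  filter_upwards [hnear, htr.eventually (gt_mem_nhds (half_pos hε))] with x' hx' hlt
  have hI : ∀ z : Eucl N, ∫ y, (Metric.ball 0 δ).indicator (rieszK N α) (z - y) < ε / (4 * (G + 1)) :=
    fun z => by
      rw [integral_sub_left_eq_self (fun y => (Metric.ball (0 : Eucl N) δ).indicator (rieszK N α) y)]
      exact hδ
  have hTint : Integrable fun y =>
      |rieszTrunc N α δ (x' - y) - rieszTrunc N α δ (x - y)| * g y :=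
    (hB.const_mul 2).mono' (hmeasT x') (ae_of_all _ (hbd x' hx'))
  have hi1 := (integrable_indicator_rieszK_sub hN hα δ x').const_mul G
  have hi2 := (integrable_indicator_rieszK_sub hN hα δ x).const_mul G
  have hnn : 0 ≤ ∫ y, |rieszK N α (x' - y) - rieszK N α (x - y)| * g y :=
    integral_nonneg fun y => mul_nonneg (abs_nonneg _) (hg.nonneg y)
  rw [Real.dist_eq, sub_zero, abs_of_nonneg hnn]
  have hle : ∫ y, |rieszK N α (x' - y) - rieszK N α (x - y)| * g y ≤
      ∫ y, (G * (Metric.ball 0 δ).indicator (rieszK N α) (x' - y) +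
        G * (Metric.ball 0 δ).indicator (rieszK N α) (x - y) +
        |rieszTrunc N α δ (x' - y) - rieszTrunc N α δ (x - y)| * g y) := by
    refine integral_mono_of_nonneg (ae_of_all _ fun y => mul_nonneg (abs_nonneg _) (hg.nonneg y))
      ((hi1.add hi2).add hTint) ?_
    filter_upwards [ae_sub_ne_zero hN x, ae_sub_ne_zero hN x'] with y hy hy'
    have h1 := indicator_rieszK_mul_le (α := α) hG hδ1 hxR y
    have h2 := indicator_rieszK_mul_le (α := α) hG hδ1 hx' y
    have h3 := abs_rieszK_sub_rieszTrunc_le (δ := δ) hαN hy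
    have h4 := abs_rieszK_sub_rieszTrunc_le (δ := δ) hαN hy'
    have h5 : |rieszK N α (x' - y) - rieszK N α (x - y)| ≤
        (Metric.ball 0 δ).indicator (rieszK N α) (x' - y) +
        (Metric.ball 0 δ).indicator (rieszK N α) (x - y) +
        |rieszTrunc N α δ (x' - y) - rieszTrunc N α δ (x - y)| := by
      have e : rieszK N α (x' - y) - rieszK N α (x - y) =
        (rieszK N α (x' - y) - rieszTrunc N α δ (x' - y)) -
        (rieszK N α (x - y) - rieszTrunc N α δ (x - y)) +
        (rieszTrunc N α δ (x' - y) - rieszTrunc N α δ (x - y)) := by ring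
      rw [e]
      refine (abs_add_le _ _).trans (add_le_add_left ((abs_sub _ _).trans (add_le_add h4 h3)) _)
    have h6 := mul_le_mul_of_nonneg_right h5 (hg.nonneg y)
    linarith
  have heq : ∫ y, (G * (Metric.ball 0 δ).indicator (rieszK N α) (x' - y) +
        G * (Metric.ball 0 δ).indicator (rieszK N α) (x - y) +
        |rieszTrunc N α δ (x' - y) - rieszTrunc N α δ (x - y)| * g y) =
      G * (∫ y, (Metric.ball 0 δ).indicator (rieszK N α) (x' - y)) +
      G * (∫ y, (Metric.ball 0 δ).indicator (rieszK N α) (x - y)) +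
      ∫ y, |rieszTrunc N α δ (x' - y) - rieszTrunc N α δ (x - y)| * g y := by
    have hi12 : Integrable fun y => G * (Metric.ball 0 δ).indicator (rieszK N α) (x' - y) +
        G * (Metric.ball 0 δ).indicator (rieszK N α) (x - y) := hi1.add hi2
    rw [integral_add hi12 hTint, integral_add hi1 hi2, integral_const_mul,
      integral_const_mul]
  have h7 : ∀ z : Eucl N, G * (∫ y, (Metric.ball 0 δ).indicator (rieszK N α) (z - y)) ≤ ε / 4 := by
    intro z
    calc _ ≤ (G + 1) * (ε / (4 * (G + 1))) := by
          refine mul_le_mul (by linarith) (hI z).le (integral_nonneg fun y =>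
            Set.indicator_apply_nonneg fun _ => rieszK_nonneg _) (by positivity)
      _ = ε / 4 := by field_simp
  linarith [h7 x, h7 x']

end riesz

section resolvent

variable {ψ : ℝ → ℝ}

lemma strictMono_add_mul (hψm : Monotone ψ) {b : ℝ} (hb : 0 ≤ b) :
    StrictMono fun s => s + b * ψ s := fun _ _ hst =>
  add_lt_add_of_lt_of_le hst (mul_le_mul_of_nonneg_left (hψm hst.le) hb)

lemma exists_add_mul_eq (hψc : Continuous ψ) (hψm : Monotone ψ) (hψ0 : ∀ t ≤ 0, ψ t = 0)
    {b : ℝ} (hb : 0 ≤ b) (t : ℝ) : ∃ s, s + b * ψ s = t := by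
  have hc : ContinuousOn (fun s => s + b * ψ s) (Set.Icc (min t 0) (max t 0)) := by fun_prop
  have hmem : t ∈ Set.Icc (min t 0 + b * ψ (min t 0)) (max t 0 + b * ψ (max t 0)) := by
    constructor
    · simp [hψ0 _ (min_le_right t 0)]
    · have : 0 ≤ ψ (max t 0) := (hψ0 0 le_rfl).ge.trans (hψm (le_max_right _ _))
      have := mul_nonneg hb this
      have := le_max_left t 0
      linarith
  obtain ⟨s, -, hs⟩ := intermediate_value_Icc (min_le_max) hc hmem
  exact ⟨s, hs⟩

/-- The inverse of `s ↦ s + b * ψ s`. -/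
def addResolvent (ψ : ℝ → ℝ) (b t : ℝ) : ℝ := Classical.epsilon fun s => s + b * ψ s = t

variable (hψc : Continuous ψ) (hψm : Monotone ψ) (hψ0 : ∀ t ≤ 0, ψ t = 0)
include hψc hψm hψ0

lemma resolvent_spec {b : ℝ} (hb : 0 ≤ b) (t : ℝ) :
    addResolvent ψ b t + b * ψ (addResolvent ψ b t) = t :=
  Classical.epsilon_spec (p := fun s => s + b * ψ s = t) (exists_add_mul_eq hψc hψm hψ0 hb t)

lemma resolvent_le_iff {b : ℝ} (hb : 0 ≤ b) (t q : ℝ) :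
    addResolvent ψ b t ≤ q ↔ t ≤ q + b * ψ q := by
  conv_rhs => rw [← resolvent_spec hψc hψm hψ0 hb t]
  exact (strictMono_add_mul hψm hb).le_iff_le.symm

lemma resolvent_nonneg {b t : ℝ} (hb : 0 ≤ b) (ht : 0 ≤ t) : 0 ≤ addResolvent ψ b t := by
  by_contra! h
  have h1 := strictMono_add_mul hψm hb h
  simp only [resolvent_spec hψc hψm hψ0 hb t, hψ0 0 le_rfl] at h1
  linarith

lemma resolvent_mono {b t t' : ℝ} (hb : 0 ≤ b) (h : t ≤ t') :
    addResolvent ψ b t ≤ addResolvent ψ b t' := by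
  rw [resolvent_le_iff hψc hψm hψ0 hb, resolvent_spec hψc hψm hψ0 hb]
  exact h

lemma resolvent_le_self {b t : ℝ} (hb : 0 ≤ b) (ht : 0 ≤ t) : addResolvent ψ b t ≤ t := by
  rw [resolvent_le_iff hψc hψm hψ0 hb]
  have : 0 ≤ ψ t := by rw [← hψ0 0 le_rfl]; exact hψm ht
  have := mul_nonneg hb this
  linarith

lemma measurable_resolvent {X : Type*} [MeasurableSpace X] {h T : X → ℝ} (hh : Measurable h)
    (hh0 : ∀ x, 0 ≤ h x) (hT : Measurable T) : Measurable fun x => addResolvent ψ (h x) (T x) := by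
  refine measurable_of_Iic fun q => ?_
  have : (fun x => addResolvent ψ (h x) (T x)) ⁻¹' Set.Iic q = {x | T x ≤ q + h x * ψ q} := by
    ext x
    exact resolvent_le_iff hψc hψm hψ0 (hh0 x) _ _
  rw [this]
  exact measurableSet_le hT (by fun_prop)

end resolvent

section jump

variable {N : ℕ} {p : Eucl N → ℝ}

/-- One step of the jump process with kernel `p` of mass `m`, restarted at value one. -/
def jumpStep (p : Eucl N → ℝ) (m : ℝ) (u : Eucl N → ℝ) (x : Eucl N) : ℝ :=
  (∫ y, p (x - y) * u y) + (1 - m)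

lemma measurable_jumpStep (hp : Measurable p) (m : ℝ) {u : Eucl N → ℝ} (hu : Measurable u) :
    Measurable (jumpStep p m u) := by
  have h : Measurable fun z : Eucl N × Eucl N => p (z.1 - z.2) * u z.2 :=
    (hp.comp (measurable_fst.sub measurable_snd)).mul (hu.comp measurable_snd)
  exact (h.stronglyMeasurable.integral_prod_right).measurable.add_const _

lemma integrable_sub_mul (hpi : Integrable p) {u : Eucl N → ℝ} (hu : Measurable u) {M : ℝ}
    (hM : ∀ x, |u x| ≤ M) (x : Eucl N) : Integrable fun y => p (x - y) * u y := by
  have h := (hpi.comp_sub_left x).bdd_mul (c := M) hu.aestronglyMeasurable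
    (ae_of_all _ fun y => by simpa using hM y)
  simpa only [mul_comm] using h

variable (hp : Measurable p) (hp0 : ∀ x, 0 ≤ p x) (hpi : Integrable p)
include hp0 hpi

lemma jumpStep_mono (m : ℝ) {u w : Eucl N → ℝ} (hu : Measurable u) (hw : Measurable w)
    (hu0 : ∀ x, u x ∈ Set.Icc (0 : ℝ) 1) (hw0 : ∀ x, w x ∈ Set.Icc (0 : ℝ) 1)
    (h : ∀ x, u x ≤ w x) (x : Eucl N) : jumpStep p m u x ≤ jumpStep p m w x := by
  have hb : ∀ {f : Eucl N → ℝ}, (∀ x, f x ∈ Set.Icc (0 : ℝ) 1) → ∀ x, |f x| ≤ 1 := fun hf x =>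
    abs_le.2 ⟨by linarith [(hf x).1], (hf x).2⟩
  refine add_le_add_left (integral_mono (integrable_sub_mul hpi hu (hb hu0) x)
    (integrable_sub_mul hpi hw (hb hw0) x) fun y => ?_) _
  exact mul_le_mul_of_nonneg_left (h y) (hp0 _)

omit hp0 hpi in
lemma jumpStep_one {m : ℝ} (hm : ∫ x, p x = m) (x : Eucl N) :
    jumpStep p m (fun _ => 1) x = 1 := by
  simp only [jumpStep, mul_one]
  rw [integral_sub_left_eq_self p volume x, hm]
  ring

omit hpi in
lemma jumpStep_nonneg {m : ℝ} (hm1 : m ≤ 1) {u : Eucl N → ℝ}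
    (hu0 : ∀ x, u x ∈ Set.Icc (0 : ℝ) 1) (x : Eucl N) : 0 ≤ jumpStep p m u x :=
  add_nonneg (integral_nonneg fun y => mul_nonneg (hp0 _) (hu0 y).1) (by linarith)

include hp

theorem exists_discrete_solution {m : ℝ} (hm : ∫ x, p x = m) (hm1 : m ≤ 1)
    {ψ : ℝ → ℝ} (hψc : Continuous ψ) (hψm : Monotone ψ) (hψ0 : ∀ t ≤ 0, ψ t = 0)
    {h : Eucl N → ℝ} (hh : Measurable h) (hh0 : ∀ x, 0 ≤ h x) :
    ∃ u : Eucl N → ℝ, Measurable u ∧ (∀ x, u x ∈ Set.Icc (0 : ℝ) 1) ∧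
      ∀ x, u x + h x * ψ (u x) = (∫ y, p (x - y) * u y) + (1 - m) := by
  let U : ℕ → Eucl N → ℝ := fun k =>
    Nat.rec (fun _ => 1) (fun _ u x => addResolvent ψ (h x) (jumpStep p m u x)) k
  have hU0 : U 0 = fun _ => 1 := rfl
  have hUs : ∀ k, U (k + 1) = fun x => addResolvent ψ (h x) (jumpStep p m (U k) x) := fun k => rfl
  have hstep1 : ∀ {u : Eucl N → ℝ}, Measurable u → (∀ x, u x ∈ Set.Icc (0 : ℝ) 1) →
      ∀ x, jumpStep p m u x ≤ 1 := fun {u} hu hu0 x => by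
    rw [← jumpStep_one hm x]
    exact jumpStep_mono hp0 hpi m hu measurable_const hu0 (fun _ => ⟨zero_le_one, le_rfl⟩)
      (fun x => (hu0 x).2) x
  have key : ∀ k, Measurable (U k) ∧ (∀ x, U k x ∈ Set.Icc (0 : ℝ) 1) := by
    intro k
    induction k with
    | zero => exact ⟨measurable_const, fun _ => ⟨zero_le_one, le_rfl⟩⟩
    | succ k ih =>
      rw [hUs]
      refine ⟨measurable_resolvent hψc hψm hψ0 hh hh0 (measurable_jumpStep hp m ih.1), fun x => ?_⟩
      have h0 := jumpStep_nonneg hp0 hm1 ih.2 x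
      exact ⟨resolvent_nonneg hψc hψm hψ0 (hh0 x) h0,
        (resolvent_le_self hψc hψm hψ0 (hh0 x) h0).trans (hstep1 ih.1 ih.2 x)⟩
  have hanti : ∀ k x, U (k + 1) x ≤ U k x := by
    intro k
    induction k with
    | zero => exact fun x => ((key 1).2 x).2
    | succ k ih =>
      intro x
      rw [congrFun (hUs (k + 1)) x, congrFun (hUs k) x]
      exact resolvent_mono hψc hψm hψ0 (hh0 x)
        (jumpStep_mono hp0 hpi m (key (k + 1)).1 (key k).1 (key (k + 1)).2 (key k).2 ih x)
  have hlim : ∀ x, Tendsto (fun k => U k x) atTop (𝓝 (⨅ k, U k x)) := fun x =>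
    tendsto_atTop_ciInf (antitone_nat_of_succ_le fun k => hanti k x)
      ⟨0, by rintro _ ⟨k, rfl⟩; exact ((key k).2 x).1⟩
  set u : Eucl N → ℝ := fun x => ⨅ k, U k x with hu
  have hum : Measurable u := measurable_of_tendsto_metrizable (fun k => (key k).1)
    (tendsto_pi_nhds.2 hlim)
  have hu0 : ∀ x, u x ∈ Set.Icc (0 : ℝ) 1 := fun x =>
    isClosed_Icc.mem_of_tendsto (hlim x) (Eventually.of_forall fun k => (key k).2 x)
  refine ⟨u, hum, hu0, fun x => ?_⟩
  have h1 : Tendsto (fun k => U (k + 1) x + h x * ψ (U (k + 1) x)) atTop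
      (𝓝 (u x + h x * ψ (u x))) := by
    have := (hlim x).comp (tendsto_add_atTop_nat 1)
    exact this.add (((hψc.tendsto _).comp this).const_mul _)
  have h2 : Tendsto (fun k => jumpStep p m (U k) x) atTop (𝓝 (jumpStep p m u x)) := by
    refine Tendsto.add_const _ (tendsto_integral_of_dominated_convergence (fun y => p (x - y))
      (fun k => (integrable_sub_mul hpi (key k).1 (M := 1) (fun y => abs_le.2
        ⟨by linarith [((key k).2 y).1], ((key k).2 y).2⟩) x).aestronglyMeasurable)
      (hpi.comp_sub_left x) (fun k => ae_of_all _ fun y => ?_)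
      (ae_of_all _ fun y => (hlim y).const_mul _))
    rw [norm_of_nonneg (mul_nonneg (hp0 _) ((key k).2 y).1)]
    exact mul_le_of_le_one_right (hp0 _) ((key k).2 y).2
  refine tendsto_nhds_unique h1 (h2.congr fun k => ?_)
  rw [hUs]
  exact (resolvent_spec hψc hψm hψ0 (hh0 x) _).symm

theorem discrete_representation {v : Eucl N → ℝ} (hv : Measurable v) (hv0 : ∀ x, 0 ≤ v x)
    (hvi : Integrable v)
    (hren : ∀ x, ENNReal.ofReal (v x) = ENNReal.ofReal (p x) +
      ∫⁻ y, ENNReal.ofReal (v (x - y)) * ENNReal.ofReal (p y))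
    {m : ℝ} (hm : ∫ x, p x = m) {u F : Eucl N → ℝ} (hu : Measurable u)
    (hu0 : ∀ x, u x ∈ Set.Icc (0 : ℝ) 1) (hF : Measurable F) (hF0 : ∀ x, 0 ≤ F x)
    (heq : ∀ x, u x + F x = (∫ y, p (x - y) * u y) + (1 - m)) (x : Eucl N) :
    u x = 1 - F x - ∫ y, v (x - y) * F y := by
  have hw0 : ∀ x, 0 ≤ 1 - u x := fun x => by linarith [(hu0 x).2]
  have hw1 : ∀ x, |1 - u x| ≤ 1 := fun x => abs_le.2 ⟨by linarith [(hu0 x).2], by linarith [(hu0 x).1]⟩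
  have hu1 : ∀ x, |u x| ≤ 1 := fun x => abs_le.2 ⟨by linarith [(hu0 x).1], (hu0 x).2⟩
  have hwm : Measurable fun x => 1 - u x := measurable_const.sub hu
  have hw : ∀ x, 1 - u x = (∫ y, p (x - y) * (1 - u y)) + F x := fun x => by
    have h1 : ∫ y, p (x - y) * (1 - u y) = m - ∫ y, p (x - y) * u y := by
      simp_rw [mul_sub, mul_one]
      rw [integral_sub (hpi.comp_sub_left x) (integrable_sub_mul hpi hu hu1 x),
        integral_sub_left_eq_self p volume x, hm]
    rw [h1]; linarith [heq x]
  set W : Eucl N → ENNReal := fun x => ENNReal.ofReal (1 - u x) with hW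
  set Fe : Eucl N → ENNReal := fun x => ENNReal.ofReal (F x) with hFe
  set P : Eucl N → ENNReal := fun x => ENNReal.ofReal (p x) with hP
  set V : Eucl N → ENNReal := fun x => ENNReal.ofReal (v x) with hV
  have hWm : Measurable W := hwm.ennreal_ofReal
  have hFm : Measurable Fe := hF.ennreal_ofReal
  have hPm : Measurable P := hp.ennreal_ofReal
  have hVm : Measurable V := hv.ennreal_ofReal
  have hWe : ∀ x, W x = (∫⁻ y, P (x - y) * W y) + Fe x := fun x => by
    rw [hW]
    simp only
    rw [hw x, ENNReal.ofReal_add (integral_nonneg fun y => mul_nonneg (hp0 _) (hw0 y)) (hF0 x),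
      ofReal_integral_eq_lintegral_ofReal (integrable_sub_mul hpi hwm hw1 x)
        (ae_of_all _ fun y => mul_nonneg (hp0 _) (hw0 y))]
    simp_rw [ENNReal.ofReal_mul (hp0 _)]
    rfl
  have hVs : Measurable fun y => V (x - y) := hVm.comp (measurable_const.sub measurable_id)
  have hPs : Measurable fun y => P (x - y) := hPm.comp (measurable_const.sub measurable_id)
  have hPP : Measurable fun z : Eucl N × Eucl N => P (z.1 - z.2) * W z.2 :=
    (hPm.comp (measurable_fst.sub measurable_snd)).mul (hWm.comp measurable_snd)
  have hPW : Measurable fun y => ∫⁻ z, P (y - z) * W z := hPP.lintegral_prod_right'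
  set J := ∫⁻ y, V (x - y) * ∫⁻ z, P (y - z) * W z with hJ
  have hI : ∫⁻ y, V (x - y) * W y = J + ∫⁻ y, V (x - y) * Fe y := by
    rw [hJ, ← lintegral_add_left (show Measurable fun y => V (x - y) * ∫⁻ z, P (y - z) * W z from hVs.mul hPW)]
    refine lintegral_congr fun y => ?_
    rw [← mul_add, ← hWe]
  have hJ2 : J = ∫⁻ z, (∫⁻ y, V (x - z - y) * P y) * W z := by
    have e1 : ∀ y, V (x - y) * ∫⁻ z, P (y - z) * W z = ∫⁻ z, V (x - y) * (P (y - z) * W z) :=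
      fun y => by
        rw [lintegral_const_mul]
        exact (hPm.comp (measurable_const.sub measurable_id)).mul hWm
    rw [hJ]
    simp_rw [e1]
    rw [lintegral_lintegral_swap]
    · refine lintegral_congr fun z => ?_
      have e2 : ∀ y, V (x - y) * (P (y - z) * W z) = (V (x - y) * P (y - z)) * W z := fun y =>
        (mul_assoc _ _ _).symm
      simp_rw [e2]
      rw [lintegral_mul_const]
      · congr 1
        rw [← lintegral_sub_right_eq_self (fun y => V (x - z - y) * P y) z]
        refine lintegral_congr fun y => ?_
        rw [sub_sub_sub_cancel_right]
      · exact hVs.mul (hPm.comp (measurable_id.sub measurable_const))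
    · refine Measurable.aemeasurable ?_
      exact (hVs.comp measurable_fst).mul hPP
  have hII : ∫⁻ y, V (x - y) * W y = (∫⁻ y, P (x - y) * W y) + J := by
    rw [hJ2, ← lintegral_add_left
      (show Measurable fun y => P (x - y) * W y from hPs.mul hWm)]
    refine lintegral_congr fun y => ?_
    rw [← add_mul]
    congr 1
    exact hren (x - y)
  have hJtop : J ≠ ⊤ := by
    refine ne_top_of_le_ne_top ?_ (le_of_le_of_eq (le_add_left le_rfl) hII.symm)
    have : ∫⁻ y, V (x - y) * W y ≤ ∫⁻ y, V (x - y) := by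
      refine lintegral_mono fun y => ?_
      refine mul_le_of_le_one_right (zero_le) ?_
      exact ENNReal.ofReal_le_one.2 (by linarith [(hu0 y).1])
    refine ne_top_of_le_ne_top ?_ this
    rw [lintegral_sub_left_eq_self V x]
    exact (hvi.lintegral_lt_top).ne
  have hPF : ∫⁻ y, P (x - y) * W y = ∫⁻ y, V (x - y) * Fe y := by
    rw [hII, add_comm J] at hI
    exact (ENNReal.add_left_inj hJtop).1 hI
  have hfin := hWe x
  rw [hPF] at hfin
  have hint : ∫ y, v (x - y) * F y = (∫⁻ y, V (x - y) * Fe y).toReal := by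
    have hvF : Measurable fun y => v (x - y) * F y :=
      (hv.comp (measurable_const.sub measurable_id)).mul hF
    rw [integral_eq_lintegral_of_nonneg_ae (ae_of_all _ fun y => mul_nonneg (hv0 _) (hF0 y))
      hvF.aestronglyMeasurable]
    simp_rw [ENNReal.ofReal_mul (hv0 _)]
    rfl
  have hne : ∫⁻ y, V (x - y) * Fe y ≠ ⊤ := by
    refine ne_top_of_le_ne_top (b := W x) ENNReal.ofReal_ne_top ?_
    rw [hfin]; exact le_add_right le_rfl
  have hreal := congrArg ENNReal.toReal hfin
  rw [ENNReal.toReal_add hne ENNReal.ofReal_ne_top, ← hint, ENNReal.toReal_ofReal (hF0 x),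
    ENNReal.toReal_ofReal (hw0 x)] at hreal
  linarith

end jump

section extraction

variable {X : Type*} [TopologicalSpace X] [TopologicalSpace.SeparableSpace X]

/-- A pointwise bounded, equicontinuous sequence of real functions on a separable space has a
subsequence converging pointwise everywhere. -/
theorem exists_subseq_tendsto_of_equicontinuous {w : ℕ → X → ℝ}
    (hb : ∀ x, ∃ B, ∀ n, |w n x| ≤ B)
    (he : ∀ x, ∀ ε > 0, ∀ᶠ x' in 𝓝 x, ∀ n, |w n x' - w n x| < ε) :
    ∃ σ : ℕ → ℕ, StrictMono σ ∧ ∃ w' : X → ℝ,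
      ∀ x, Tendsto (fun k => w (σ k) x) atTop (𝓝 (w' x)) := by
  rcases isEmpty_or_nonempty X with hX | hX
  · exact ⟨id, strictMono_id, fun _ => 0, fun x => hX.elim x⟩
  set s := TopologicalSpace.denseSeq X
  choose B hB using hb
  have hcomp : IsCompact (Set.pi Set.univ fun i => Set.Icc (-B (s i)) (B (s i))) :=
    isCompact_univ_pi fun i => isCompact_Icc
  obtain ⟨l, -, σ, hσ, hl⟩ := hcomp.tendsto_subseq (x := fun n i => w n (s i))
    (fun n i _ => abs_le.mp (hB (s i) n))
  rw [tendsto_pi_nhds] at hl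
  have hc : ∀ x, CauchySeq fun k => w (σ k) x := by
    intro x
    rw [Metric.cauchySeq_iff']
    intro ε hε
    have hex : ∃ i, ∀ n, |w n (s i) - w n x| < ε / 3 := by
      obtain ⟨y, ⟨i, rfl⟩, hy⟩ := (TopologicalSpace.denseRange_denseSeq X).inter_nhds_nonempty
        (he x (ε / 3) (by positivity))
      exact ⟨i, hy⟩
    obtain ⟨i, hi⟩ := hex
    obtain ⟨n₀, hn₀⟩ := Metric.cauchySeq_iff'.mp (hl i).cauchySeq (ε / 3) (by positivity)
    refine ⟨n₀, fun n hn => ?_⟩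
    have h1 := hn₀ n hn
    have h2 := hi (σ n)
    have h3 := hi (σ n₀)
    simp only [Function.comp, Real.dist_eq, abs_lt] at *
    constructor <;> linarith [h1.1, h1.2, h2.1, h2.2, h3.1, h3.2]
  choose w' hw' using fun x => cauchySeq_tendsto_of_complete (hc x)
  exact ⟨σ, hσ, w', hw'⟩

end extraction

section limit

variable {N : ℕ} {α C D D' : ℝ} {p v : ℕ → Eucl N → ℝ} {m : ℕ → ℝ} {g : Eucl N → ℝ}

lemma tendsto_natCast_add_one_rpow_neg {a : ℝ} (ha : 0 < a) :
    Tendsto (fun n : ℕ => ((n : ℝ) + 1) ^ (-a)) atTop (𝓝 0) :=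
  (tendsto_rpow_neg_atTop ha).comp (tendsto_atTop_add_const_right _ 1 tendsto_natCast_atTop_atTop)

lemma RieszWeight.integrable_sub_of_abs_le (hg : RieszWeight N α g) (hN : 3 ≤ N) (hα : 0 < α)
    (hα2 : α < 2) {f : Eucl N → ℝ} (hf : Measurable f) {L : ℝ} (hL : ∀ y, |f y| ≤ L * g y)
    (x : Eucl N) : Integrable fun y => rieszK N α (x - y) * f y := by
  refine ((hg.integrable_sub hN hα hα2 x).const_mul L).mono'
    ((measurable_rieszK_sub x).mul hf).aestronglyMeasurable (.of_forall fun y => ?_)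
  rw [norm_mul, Real.norm_of_nonneg (rieszK_nonneg _), Real.norm_eq_abs]
  have := mul_le_mul_of_nonneg_left (hL y) (rieszK_nonneg (α := α) (x - y))
  linarith

lemma RieszWeight.abs_integral_sub_le (hg : RieszWeight N α g) (hN : 3 ≤ N) (hα : 0 < α)
    (hα2 : α < 2) {f : Eucl N → ℝ} (hf : Measurable f) {L : ℝ} (hL : ∀ y, |f y| ≤ L * g y)
    (x x' : Eucl N) :
    |(∫ y, rieszK N α (x' - y) * f y) - ∫ y, rieszK N α (x - y) * f y| ≤
      L * ∫ y, |rieszK N α (x' - y) - rieszK N α (x - y)| * g y := by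
  rw [← integral_sub (hg.integrable_sub_of_abs_le hN hα hα2 hf hL x')
    (hg.integrable_sub_of_abs_le hN hα hα2 hf hL x), ← integral_const_mul, ← Real.norm_eq_abs]
  refine norm_integral_le_of_norm_le ?_ (.of_forall fun y => ?_)
  · refine Integrable.const_mul ?_ L
    have := ((hg.integrable_sub hN hα hα2 x').sub (hg.integrable_sub hN hα hα2 x)).abs
    refine this.congr (.of_forall fun y => ?_)
    simp only [Pi.sub_apply]
    rw [← sub_mul, abs_mul, abs_of_nonneg (hg.nonneg y)]
  · rw [← sub_mul, norm_mul, Real.norm_eq_abs, Real.norm_eq_abs]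
    have := mul_le_mul_of_nonneg_left (hL y) (abs_nonneg (rieszK N α (x' - y) - rieszK N α (x - y)))
    linarith

/-- The discrete potentials converge to the Riesz potential. -/
lemma JumpApprox.tendsto_integral_abs_potential (hJ : JumpApprox N α C D D' p v m)
    (hg : RieszWeight N α g) (hN : 3 ≤ N) (hα : 0 < α) (hα2 : α < 2) (x : Eucl N) :
    (∀ n : ℕ, Integrable fun y => |((n : ℝ) + 1) ^ (-(α / 2)) * v n (x - y)
      - D * rieszK N α (x - y)| * g y) ∧
    Tendsto (fun n : ℕ => ∫ y, |((n : ℝ) + 1) ^ (-(α / 2)) * v n (x - y)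
      - D * rieszK N α (x - y)| * g y) atTop (𝓝 0) := by
  have hmeas : ∀ n : ℕ, Measurable fun y => |((n : ℝ) + 1) ^ (-(α / 2)) * v n (x - y)
      - D * rieszK N α (x - y)| * g y := fun n =>
    (((((hJ.v_meas n).comp (measurable_const.sub measurable_id)).const_mul _).sub
      ((measurable_rieszK_sub x).const_mul D)).abs).mul hg.meas
  have hbd : ∀ n : ℕ, ∀ᵐ y, ‖|((n : ℝ) + 1) ^ (-(α / 2)) * v n (x - y)
      - D * rieszK N α (x - y)| * g y‖ ≤ (C + D) * (rieszK N α (x - y) * g y) := by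
    intro n
    filter_upwards [ae_sub_ne_zero hN x] with y hy
    rw [Real.norm_of_nonneg (mul_nonneg (abs_nonneg _) (hg.nonneg y)), ← mul_assoc]
    refine mul_le_mul_of_nonneg_right ?_ (hg.nonneg y)
    have h1 := hJ.v_le n (x - y) hy
    have h2 : 0 ≤ ((n : ℝ) + 1) ^ (-(α / 2)) * v n (x - y) :=
      mul_nonneg (rpow_nonneg (by positivity) _) (hJ.v_nonneg n _)
    have h3 := mul_nonneg hJ.D_nonneg (rieszK_nonneg (α := α) (x - y))
    have h4 : C * ‖x - y‖ ^ (α - N) = C * rieszK N α (x - y) := rfl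
    rw [abs_le]
    have h5 : 0 ≤ C * rieszK N α (x - y) := mul_nonneg hJ.C_nonneg (rieszK_nonneg _)
    constructor <;> linarith
  have hint := (hg.integrable_sub hN hα hα2 x).const_mul (C + D)
  refine ⟨fun n => hint.mono' (hmeas n).aestronglyMeasurable (hbd n), ?_⟩
  have := tendsto_integral_of_dominated_convergence _ (fun n => (hmeas n).aestronglyMeasurable)
    hint hbd (f := fun _ => (0 : ℝ)) ?_
  · simpa using this
  · filter_upwards [ae_sub_ne_zero hN x] with y hy
    have h := ((hJ.v_lim (x - y) hy).sub_const (D * rieszK N α (x - y))).abs.mul_const (g y)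
    simpa [rieszK] using h

/-- Compactness: along a subsequence the discrete solutions converge pointwise to a continuous
nontrivial function with values in `[0, 1]`. -/
theorem JumpApprox.exists_limit (hJ : JumpApprox N α C D D' p v m)
    (hg : RieszWeight N α g) (hN : 3 ≤ N) (hα : 0 < α) (hα2 : α < 2)
    {ψ : ℝ → ℝ} (hψc : Continuous ψ) (hψm : Monotone ψ) (hψ0 : ∀ t ≤ 0, ψ t = 0) :
    ∃ (U : ℕ → Eucl N → ℝ) (σ : ℕ → ℕ) (u : Eucl N → ℝ),
      (∀ n, Measurable (U n)) ∧ (∀ n x, U n x ∈ Set.Icc (0 : ℝ) 1) ∧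
      (∀ (n : ℕ) x, U n x + ((n : ℝ) + 1) ^ (-(α / 2)) * g x * ψ (U n x) =
        (∫ y, p n (x - y) * U n y) + (1 - m n)) ∧
      StrictMono σ ∧ (∀ x, Tendsto (fun k => U (σ k) x) atTop (𝓝 (u x))) ∧
      Continuous u ∧ (∀ x, u x ∈ Set.Icc (0 : ℝ) 1) ∧ ∃ x, u x ≠ 0 := by
  have hpow : ∀ n : ℕ, 0 ≤ ((n : ℝ) + 1) ^ (-(α / 2)) := fun n => rpow_nonneg (by positivity) _
  have hψnn : ∀ t, 0 ≤ ψ t := fun t => by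
    rw [← hψ0 (min t 0) (min_le_right _ _)]; exact hψm (min_le_left _ _)
  choose U hUm hU01 hUeq using fun n : ℕ => exists_discrete_solution (hJ.p_meas n)
    (hJ.p_nonneg n) (hJ.p_int n) (hJ.integral_p n) (hJ.m_le n) hψc hψm hψ0
    (h := fun x => ((n : ℝ) + 1) ^ (-(α / 2)) * g x) (hg.meas.const_mul _)
    (fun x => mul_nonneg (hpow n) (hg.nonneg x))
  set f : ℕ → Eucl N → ℝ := fun n x => g x * ψ (U n x) with hf
  have hfm : ∀ n, Measurable (f n) := fun n => hg.meas.mul (hψc.measurable.comp (hUm n))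
  have hf0 : ∀ n x, 0 ≤ f n x := fun n x => mul_nonneg (hg.nonneg x) (hψnn _)
  have hfL : ∀ n x, |f n x| ≤ ψ 1 * g x := fun n x => by
    rw [abs_of_nonneg (hf0 n x), mul_comm (ψ 1)]
    exact mul_le_mul_of_nonneg_left (hψm (hU01 n x).2) (hg.nonneg x)
  set I : ℕ → Eucl N → ℝ := fun n x => ∫ y, rieszK N α (x - y) * f n y with hI
  have hIbd : ∀ x, ∃ B, ∀ n, |I n x| ≤ B := fun x => by
    refine ⟨∫ y, ψ 1 * (rieszK N α (x - y) * g y), fun n => ?_⟩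
    rw [← Real.norm_eq_abs]
    refine norm_integral_le_of_norm_le ((hg.integrable_sub hN hα hα2 x).const_mul _)
      (.of_forall fun y => ?_)
    rw [norm_mul, Real.norm_of_nonneg (rieszK_nonneg _), Real.norm_eq_abs]
    have := mul_le_mul_of_nonneg_left (hfL n y) (rieszK_nonneg (α := α) (x - y))
    linarith
  have hIe : ∀ x, ∀ ε > 0, ∀ᶠ x' in 𝓝 x, ∀ n, |I n x' - I n x| < ε := fun x ε hε => by
    have h := (hg.tendsto_integral_abs_sub hN hα hα2 x).const_mul (ψ 1)
    rw [mul_zero] at h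
    filter_upwards [h.eventually_lt_const hε] with x' hx' n
    exact (hg.abs_integral_sub_le hN hα hα2 (hfm n) (hfL n) x x').trans_lt hx'
  obtain ⟨σ, hσ, I', hI'⟩ := exists_subseq_tendsto_of_equicontinuous hIbd hIe
  have hdiff : ∀ x, Tendsto (fun n => U n x - (1 - D * I n x)) atTop (𝓝 0) := by
    intro x
    obtain ⟨hKi, hKl⟩ := hJ.tendsto_integral_abs_potential hg hN hα hα2 x
    have hb : Tendsto (fun n : ℕ => ((n : ℝ) + 1) ^ (-(α / 2)) * (ψ 1 * g x) +
        ψ 1 * ∫ y, |((n : ℝ) + 1) ^ (-(α / 2)) * v n (x - y) - D * rieszK N α (x - y)| * g y)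
        atTop (𝓝 0) := by
      simpa using ((tendsto_natCast_add_one_rpow_neg (half_pos hα)).mul_const (ψ 1 * g x)).add
        (hKl.const_mul (ψ 1))
    refine squeeze_zero_norm (fun n => ?_) hb
    have hrep := discrete_representation (hJ.p_meas n) (hJ.p_nonneg n) (hJ.p_int n)
      (hJ.v_meas n) (hJ.v_nonneg n) (hJ.v_int n) (hJ.renewal n) (hJ.integral_p n) (hUm n)
      (hU01 n) (F := fun x => ((n : ℝ) + 1) ^ (-(α / 2)) * f n x) ((hfm n).const_mul _)
      (fun x => mul_nonneg (hpow n) (hf0 n x))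
      (fun x => by rw [← hUeq n x, hf]; ring) x
    have hDi := (hg.integrable_sub_of_abs_le hN hα hα2 (hfm n) (hfL n) x).const_mul D
    have hle : ∀ y, ‖(((n : ℝ) + 1) ^ (-(α / 2)) * v n (x - y) - D * rieszK N α (x - y)) * f n y‖
        ≤ ψ 1 * (|((n : ℝ) + 1) ^ (-(α / 2)) * v n (x - y) - D * rieszK N α (x - y)| * g y) := by
      intro y
      rw [norm_mul, Real.norm_eq_abs, Real.norm_eq_abs]
      have := mul_le_mul_of_nonneg_left (hfL n y)
        (abs_nonneg (((n : ℝ) + 1) ^ (-(α / 2)) * v n (x - y) - D * rieszK N α (x - y)))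
      linarith
    have hEi : Integrable fun y =>
        (((n : ℝ) + 1) ^ (-(α / 2)) * v n (x - y) - D * rieszK N α (x - y)) * f n y :=
      ((hKi n).const_mul (ψ 1)).mono'
        (((((hJ.v_meas n).comp (measurable_const.sub measurable_id)).const_mul _).sub
          ((measurable_rieszK_sub x).const_mul D)).mul (hfm n)).aestronglyMeasurable
        (.of_forall hle)
    have hsplit : ∫ y, v n (x - y) * (((n : ℝ) + 1) ^ (-(α / 2)) * f n y) =
        (∫ y, (((n : ℝ) + 1) ^ (-(α / 2)) * v n (x - y) - D * rieszK N α (x - y)) * f n y)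
          + D * I n x := by
      rw [hI, ← integral_const_mul, ← integral_add hEi hDi]
      congr 1 with y
      ring
    rw [hrep, hsplit]
    have h1 : ‖∫ y, (((n : ℝ) + 1) ^ (-(α / 2)) * v n (x - y) - D * rieszK N α (x - y)) * f n y‖
        ≤ ψ 1 * ∫ y, |((n : ℝ) + 1) ^ (-(α / 2)) * v n (x - y) - D * rieszK N α (x - y)| * g y := by
      rw [← integral_const_mul]
      exact norm_integral_le_of_norm_le ((hKi n).const_mul (ψ 1)) (.of_forall hle)
    have h2 : ((n : ℝ) + 1) ^ (-(α / 2)) * f n x ≤ ((n : ℝ) + 1) ^ (-(α / 2)) * (ψ 1 * g x) :=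
      mul_le_mul_of_nonneg_left ((le_abs_self _).trans (hfL n x)) (hpow n)
    have h3 := mul_nonneg (hpow n) (hf0 n x)
    rw [Real.norm_eq_abs, abs_le] at h1 ⊢
    constructor <;> linarith [h1.1, h1.2]
  set u : Eucl N → ℝ := fun x => 1 - D * I' x with hu
  have hlim : ∀ x, Tendsto (fun k => U (σ k) x) atTop (𝓝 (u x)) := by
    intro x
    have h := ((hdiff x).comp hσ.tendsto_atTop).add (((hI' x).const_mul D).const_sub 1)
    simpa [Function.comp_def] using h
  have hI'c : Continuous I' := by
    rw [Metric.continuous_iff']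
    intro x ε hε
    filter_upwards [hIe x (ε / 2) (by positivity)] with x' hx'
    have h := ((hI' x').sub (hI' x)).abs
    have := le_of_tendsto h (.of_forall fun k => (hx' (σ k)).le)
    rw [Real.dist_eq]
    linarith
  have hu01 : ∀ x, u x ∈ Set.Icc (0 : ℝ) 1 := fun x =>
    isClosed_Icc.mem_of_tendsto (hlim x) (.of_forall fun k => hU01 (σ k) x)
  refine ⟨U, σ, u, hUm, hU01, hUeq, hσ, hlim, by fun_prop, hu01, ?_⟩
  by_contra! h0
  have hI0 : Tendsto (fun k => I (σ k) 0) atTop (𝓝 0) := by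
    have := tendsto_integral_of_dominated_convergence
      (fun y => ψ 1 * (rieszK N α (0 - y) * g y))
      (F := fun k y => rieszK N α (0 - y) * f (σ k) y) (f := fun _ => (0 : ℝ))
      (fun k => ((measurable_rieszK_sub 0).mul (hfm _)).aestronglyMeasurable)
      ((hg.integrable_sub hN hα hα2 0).const_mul _)
      (fun k => .of_forall fun y => by
        rw [norm_mul, Real.norm_of_nonneg (rieszK_nonneg _), Real.norm_eq_abs]
        have := mul_le_mul_of_nonneg_left (hfL (σ k) y) (rieszK_nonneg (α := α) (0 - y))
        linarith)
      (.of_forall fun y => by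
        have h1 := ((hψc.tendsto _).comp (hlim y)).const_mul (g y)
        have h2 := h1.const_mul (rieszK N α (0 - y))
        simpa [h0 y, hψ0 0 le_rfl, hf, Function.comp_def] using h2)
    simpa [hI] using this
  have h1 := tendsto_nhds_unique (hI' 0) hI0
  have h2 := h0 0
  simp [hu, h1] at h2

end limit

section secondDifference

variable {N : ℕ} {θ : Eucl N → ℝ}

/-- The symmetric second difference of `θ` with step `z`. -/
def secondDiff (θ : Eucl N → ℝ) (z x : Eucl N) : ℝ := θ (x + z) + θ (x - z) - 2 * θ x

lemma exists_abs_secondDiff_le (hθ : ContDiff ℝ (⊤ : ℕ∞) θ) (hc : HasCompactSupport θ) :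
    ∃ B : ℝ, 0 ≤ B ∧ ∀ z x, |secondDiff θ z x| ≤ B * ‖z‖ ^ 2 := by
  obtain ⟨K, hK⟩ := ContDiff.lipschitzWith_of_hasCompactSupport (𝕂 := ℝ) (n := 1)
    (hc.fderiv (𝕜 := ℝ)) (hθ.fderiv_right (by norm_cast)) one_ne_zero
  have hd : Differentiable ℝ θ := hθ.differentiable (by simp)
  refine ⟨K, K.2, fun z x => ?_⟩
  have hG : ∀ y, HasFDerivAt (fun y => θ (y + z) - θ y) (fderiv ℝ θ (y + z) - fderiv ℝ θ y) y :=
    fun y => ((hasFDerivAt_comp_add_right z).mpr (hd (y + z)).hasFDerivAt).sub (hd y).hasFDerivAt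
  have h := Convex.norm_image_sub_le_of_norm_hasFDerivWithin_le (s := Set.univ)
    (C := K * ‖z‖) (fun y _ => (hG y).hasFDerivWithinAt) (fun y _ => by
      have := hK.dist_le_mul (y + z) y
      rwa [dist_eq_norm, dist_eq_norm, add_sub_cancel_left] at this)
    convex_univ (Set.mem_univ (x - z)) (Set.mem_univ x)
  rw [Real.norm_eq_abs, sub_sub_cancel, sub_add_cancel] at h
  calc |secondDiff θ z x| = |θ (x + z) - θ x - (θ x - θ (x - z))| := by
        rw [secondDiff]; congr 1; ring
    _ ≤ _ := h
    _ = K * ‖z‖ ^ 2 := by ring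

lemma integrable_secondDiff (hθ : Integrable θ) (z : Eucl N) : Integrable (secondDiff θ z) :=
  ((hθ.comp_add_right z).add (hθ.comp_sub_right z)).sub (hθ.const_mul 2)

lemma integral_abs_secondDiff_le (hθ : Integrable θ) (z : Eucl N) :
    ∫ x, |secondDiff θ z x| ≤ 4 * ∫ x, |θ x| := by
  have h1 := (hθ.comp_add_right z).abs
  have h2 := (hθ.comp_sub_right z).abs
  have h3 := (hθ.abs).const_mul 2
  calc ∫ x, |secondDiff θ z x| ≤ ∫ x, (|θ (x + z)| + |θ (x - z)| + 2 * |θ x|) := by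
        refine integral_mono (integrable_secondDiff hθ z).abs ((h1.add h2).add h3) fun x => ?_
        simp only [secondDiff]
        refine (abs_sub _ _).trans (add_le_add (abs_add_le _ _) ?_)
        rw [abs_mul, abs_two]
    _ = (∫ x, |θ (x + z)|) + (∫ x, |θ (x - z)|) + 2 * ∫ x, |θ x| := by
        have h12 := integral_add (h1.add h2) h3
        simp only [Pi.add_apply] at h12
        rw [h12, integral_add h1 h2, integral_const_mul]
    _ = 4 * ∫ x, |θ x| := by
        rw [integral_add_right_eq_self (fun x => |θ x|) z,
          integral_sub_right_eq_self (fun x => |θ x|) z]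
        ring

lemma exists_integral_abs_secondDiff_le (hθ : ContDiff ℝ (⊤ : ℕ∞) θ) (hc : HasCompactSupport θ) :
    ∃ A : ℝ, 0 ≤ A ∧ ∀ z, ∫ x, |secondDiff θ z x| ≤ A * min 1 (‖z‖ ^ 2) := by
  have hθi : Integrable θ := hθ.continuous.integrable_of_hasCompactSupport hc
  obtain ⟨B, hB0, hB⟩ := exists_abs_secondDiff_le hθ hc
  obtain ⟨R, hR⟩ := hc.isCompact.isBounded.subset_closedBall 0
  have hθR : ∀ x, R < ‖x‖ → θ x = 0 := fun x hx => by
    by_contra h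
    have := hR (subset_tsupport θ h)
    rw [mem_closedBall_zero_iff] at this
    linarith
  set V := volume.real (Metric.closedBall (0 : Eucl N) (R + 1)) with hV
  have hI0 : 0 ≤ ∫ x, |θ x| := integral_nonneg fun x => abs_nonneg _
  have hV0 : 0 ≤ V := measureReal_nonneg
  refine ⟨4 * (∫ x, |θ x|) + B * V, by positivity, fun z => ?_⟩
  rcases le_or_gt 1 ‖z‖ with hz | hz
  · rw [min_eq_left (one_le_pow₀ hz), mul_one]
    have := integral_abs_secondDiff_le hθi z
    have := mul_nonneg hB0 hV0
    linarith
  · rw [min_eq_right (pow_le_one₀ (norm_nonneg _) hz.le)]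
    have hle : ∀ x, |secondDiff θ z x| ≤
        (Metric.closedBall (0 : Eucl N) (R + 1)).indicator (fun _ => B * ‖z‖ ^ 2) x := by
      intro x
      by_cases hx : x ∈ Metric.closedBall (0 : Eucl N) (R + 1)
      · rw [Set.indicator_of_mem hx]; exact hB z x
      · rw [Set.indicator_of_notMem hx]
        rw [mem_closedBall_zero_iff, not_le] at hx
        have h1 : ‖x‖ ≤ ‖x + z‖ + ‖z‖ := by simpa using norm_sub_le (x + z) z
        have h2 : ‖x‖ ≤ ‖x - z‖ + ‖z‖ := by simpa using norm_add_le (x - z) z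
        rw [secondDiff, hθR _ (by linarith), hθR _ (by linarith), hθR _ (by linarith)]
        simp
    calc ∫ x, |secondDiff θ z x|
        ≤ ∫ x, (Metric.closedBall (0 : Eucl N) (R + 1)).indicator (fun _ => B * ‖z‖ ^ 2) x := by
          refine integral_mono (integrable_secondDiff hθi z).abs ?_ hle
          rw [integrable_indicator_iff Metric.isClosed_closedBall.measurableSet]
          exact integrableOn_const (Metric.isBounded_closedBall.measure_lt_top.ne)
      _ = B * V * ‖z‖ ^ 2 := by
          rw [integral_indicator Metric.isClosed_closedBall.measurableSet, setIntegral_const,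
            smul_eq_mul, hV]
          ring
      _ ≤ _ := by
          refine mul_le_mul_of_nonneg_right ?_ (by positivity)
          linarith

lemma integrable_min_mul_rpow (hN : 3 ≤ N) {α : ℝ} (hα : 0 < α) (hα2 : α < 2) :
    Integrable fun z : Eucl N => min 1 (‖z‖ ^ 2) * ‖z‖ ^ (-((N : ℝ) + α)) := by
  have : Nonempty (Fin N) := ⟨⟨0, by omega⟩⟩
  have : Nontrivial (Eucl N) := inferInstance
  rw [integrable_fun_norm_addHaar (volume : Measure (Eucl N))
    (f := fun r : ℝ => min 1 (r ^ 2) * r ^ (-((N : ℝ) + α))), finrank_euclideanSpace_fin]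
  have key : ∀ r : ℝ, 0 < r → r ^ (N - 1) • (min 1 (r ^ 2) * r ^ (-((N : ℝ) + α))) =
      min 1 (r ^ 2) * r ^ (-1 - α) := by
    intro r hr
    rw [smul_eq_mul, ← rpow_natCast r (N - 1), Nat.cast_sub (by omega), mul_left_comm,
      ← rpow_add hr]
    congr 2
    push_cast
    ring
  have hmeas : Measurable fun r : ℝ => min 1 (r ^ 2) * r ^ (-1 - α) := by fun_prop
  rw [integrableOn_congr_fun (fun r (hr : r ∈ Set.Ioi 0) => key r hr) measurableSet_Ioi,
    ← Set.Ioc_union_Ioi_eq_Ioi zero_le_one]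
  refine IntegrableOn.union ?_ ?_
  · have h : IntegrableOn (fun r : ℝ => r ^ (1 - α)) (Set.Ioc 0 1) := by
      rw [← intervalIntegrable_iff_integrableOn_Ioc_of_le zero_le_one]
      exact intervalIntegral.intervalIntegrable_rpow' (by linarith)
    refine h.mono' hmeas.aestronglyMeasurable
      (ae_restrict_of_forall_mem measurableSet_Ioc fun r hr => ?_)
    have hr0 : 0 ≤ r ^ (-1 - α) := rpow_nonneg hr.1.le _
    rw [norm_of_nonneg (by positivity)]
    calc min 1 (r ^ 2) * r ^ (-1 - α) ≤ r ^ 2 * r ^ (-1 - α) :=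
          mul_le_mul_of_nonneg_right (min_le_right _ _) hr0
      _ = r ^ (1 - α) := by
          rw [← rpow_natCast r 2, ← rpow_add hr.1]; congr 1; push_cast; ring
  · have h : IntegrableOn (fun r : ℝ => r ^ (-1 - α)) (Set.Ioi 1) :=
      integrableOn_Ioi_rpow_of_lt (by linarith) one_pos
    refine h.mono' hmeas.aestronglyMeasurable
      (ae_restrict_of_forall_mem measurableSet_Ioi fun r hr => ?_)
    have hr1 : (0 : ℝ) < r := one_pos.trans hr
    have hr0 : 0 ≤ r ^ (-1 - α) := rpow_nonneg hr1.le _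
    rw [norm_of_nonneg (by positivity)]
    exact (mul_le_mul_of_nonneg_right (min_le_left _ _) hr0).trans (one_mul _).le

end secondDifference

section weak

variable {N : ℕ} {α C D D' : ℝ}

lemma integrable_mul_of_mem_Icc {f U : Eucl N → ℝ} (hf : Integrable f) (hU : Measurable U)
    (hU01 : ∀ x, U x ∈ Set.Icc (0 : ℝ) 1) : Integrable fun x => U x * f x := by
  refine hf.bdd_mul (c := 1) hU.aestronglyMeasurable (.of_forall fun x => ?_)
  rw [Real.norm_of_nonneg (hU01 x).1]
  exact (hU01 x).2

/-- The weak form of a discrete equation `U + F = p ⋆ U + (1 - m)` with an even kernel `p`. -/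
lemma discrete_weak_form {p : Eucl N → ℝ} (hpi : Integrable p)
    (hpe : ∀ x, p (-x) = p x) {m : ℝ} (hm : ∫ x, p x = m) {U F θ : Eucl N → ℝ}
    (hU : Measurable U) (hU01 : ∀ x, U x ∈ Set.Icc (0 : ℝ) 1) (hθ : Integrable θ)
    (heq : ∀ x, U x + F x = (∫ y, p (x - y) * U y) + (1 - m)) :
    Integrable (fun z => p z * ∫ x, U x * secondDiff θ z x) ∧
    ∫ x, F x * θ x = (1 / 2) * (∫ z, p z * ∫ x, U x * secondDiff θ z x) +
      (1 - m) * ∫ x, (1 - U x) * θ x := by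
  set T : Eucl N → ℝ := fun z => ∫ x, U x * θ (x + z) with hT
  have hθz : ∀ z, Integrable fun x => U x * θ (x + z) := fun z =>
    integrable_mul_of_mem_Icc (hθ.comp_add_right z) hU hU01
  have hθz' : ∀ z, Integrable fun x => U x * θ (x - z) := fun z =>
    integrable_mul_of_mem_Icc (hθ.comp_sub_right z) hU hU01
  have hUθ := integrable_mul_of_mem_Icc hθ hU hU01
  have hprod : Integrable (fun w : Eucl N × Eucl N => U (w.1 - w.2) * (θ w.1 * p w.2))
      (volume.prod volume) := by
    refine (hθ.mul_prod hpi).bdd_mul (c := 1)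
      (hU.comp (measurable_fst.sub measurable_snd)).aestronglyMeasurable (.of_forall fun w => ?_)
    rw [Real.norm_of_nonneg (hU01 _).1]
    exact (hU01 _).2
  have hTz : ∀ z, ∫ x, U (x - z) * (θ x * p z) = p z * T z := fun z => by
    rw [hT, ← integral_add_right_eq_self (fun x => U (x - z) * (θ x * p z)) z,
      ← integral_const_mul]
    congr 1 with x
    rw [add_sub_cancel_right]
    ring
  have hpT : Integrable fun z => p z * T z :=
    hprod.integral_prod_right.congr (.of_forall fun z => hTz z)
  have hpT' : Integrable fun z => p z * T (-z) := by
    simpa [hpe] using hpT.comp_neg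
  have hsec : ∀ z, p z * (∫ x, U x * secondDiff θ z x) = p z * T z + p z * T (-z) -
      p z * (2 * T 0) := fun z => by
    have : ∫ x, U x * secondDiff θ z x = T z + T (-z) - 2 * T 0 := by
      simp only [hT, add_zero, ← sub_eq_add_neg]
      have h12 := integral_sub ((hθz z).add (hθz' z)) (hUθ.const_mul 2)
      simp only [Pi.add_apply] at h12
      rw [← integral_const_mul, ← integral_add (hθz z) (hθz' z), ← h12]
      congr 1 with x
      simp only [secondDiff]
      ring
    rw [this]; ring
  have hconst : Integrable fun z => p z * (2 * T 0) := hpi.mul_const _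
  have hswap : ∫ x, θ x * (∫ y, p (x - y) * U y) = ∫ z, p z * T z := by
    rw [← integral_congr_ae (.of_forall hTz), ← integral_integral_swap hprod]
    congr 1 with x
    rw [← integral_sub_left_eq_self (fun z => U (x - z) * (θ x * p z)) volume x,
      ← integral_const_mul]
    congr 1 with y
    rw [sub_sub_cancel]
    ring
  have hint1 : Integrable fun x => θ x * (∫ y, p (x - y) * U y) := by
    refine hprod.integral_prod_left.congr (.of_forall fun x => ?_)
    simp only
    rw [← integral_sub_left_eq_self (fun z => U (x - z) * (θ x * p z)) volume x,
      ← integral_const_mul]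
    congr 1 with y
    rw [sub_sub_cancel]
    ring
  have hsymm : ∫ z, p z * T (-z) = ∫ z, p z * T z := by
    rw [← integral_neg_eq_self (fun z => p z * T z)]
    simp only [hpe]
  refine ⟨((hpT.add hpT').sub hconst).congr (.of_forall fun z => (hsec z).symm), ?_⟩
  have hJ : ∫ z, p z * (∫ x, U x * secondDiff θ z x) = 2 * (∫ z, p z * T z) - m * (2 * T 0) := by
    have h12 := integral_sub (hpT.add hpT') hconst
    simp only [Pi.add_apply] at h12
    rw [integral_congr_ae (.of_forall hsec), h12, integral_add hpT hpT', hsymm, integral_mul_const,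
      hm]
    ring
  have hF : ∀ x, F x * θ x = θ x * (∫ y, p (x - y) * U y) + ((1 - m) * θ x - U x * θ x) :=
    fun x => by rw [eq_sub_of_add_eq' (heq x)]; ring
  have hT0 : T 0 = ∫ x, U x * θ x := by simp [hT]
  have h1U : ∫ x, (1 - U x) * θ x = (∫ x, θ x) - T 0 := by
    rw [hT0, ← integral_sub hθ hUθ]
    congr 1 with x
    ring
  have hadd := integral_add hint1 ((hθ.const_mul (1 - m)).sub hUθ)
  simp only [Pi.sub_apply] at hadd
  rw [integral_congr_ae (.of_forall hF), hadd,
    integral_sub (hθ.const_mul _) hUθ, integral_const_mul, hswap, hJ, h1U, ← hT0]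
  ring

lemma abs_integral_mul_le {f U : Eucl N → ℝ} (hf : Integrable f)
    (hU01 : ∀ x, U x ∈ Set.Icc (0 : ℝ) 1) : |∫ x, U x * f x| ≤ ∫ x, |f x| := by
  rw [← Real.norm_eq_abs]
  refine norm_integral_le_of_norm_le hf.abs (.of_forall fun x => ?_)
  rw [norm_mul, Real.norm_of_nonneg (hU01 x).1, Real.norm_eq_abs]
  exact mul_le_of_le_one_left (abs_nonneg _) (hU01 x).2

lemma RieszWeight.integrable_mul {g θ : Eucl N → ℝ} (hg : RieszWeight N α g)
    (hθ : Continuous θ) (hc : HasCompactSupport θ) : Integrable fun x => g x * θ x := by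
  obtain ⟨R, hR⟩ := hc.isCompact.isBounded.subset_closedBall 0
  obtain ⟨M, hM⟩ := hg.bdd R
  refine ((hθ.integrable_of_hasCompactSupport hc).norm.const_mul M).mono'
    (hg.meas.mul hθ.measurable).aestronglyMeasurable (.of_forall fun x => ?_)
  by_cases hx : x ∈ tsupport θ
  · rw [norm_mul, Real.norm_of_nonneg (hg.nonneg x)]
    exact mul_le_mul_of_nonneg_right (hM x (mem_closedBall_zero_iff.mp (hR hx))) (norm_nonneg _)
  · simp [image_eq_zero_of_notMem_tsupport hx]

lemma fracLapCoeff_pos (hN : 3 ≤ N) (hα : 0 < α) (hα2 : α < 2) : 0 < fracLapCoeff N α := by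
  have h1 : Real.Gamma (-α / 2) ≠ 0 := Real.Gamma_ne_zero fun k hk => by
    rcases k.eq_zero_or_pos with rfl | hk0
    · rw [Nat.cast_zero] at hk; linarith
    · have : (1 : ℝ) ≤ k := by exact_mod_cast hk0
      linarith
  have h2 : 0 < Real.Gamma (((N : ℝ) + α) / 2) := Real.Gamma_pos_of_pos (by positivity)
  rw [fracLapCoeff]
  have := abs_pos.mpr h1
  have := Real.pi_pos
  positivity

lemma fracLap_eq (θ : Eucl N → ℝ) (x : Eucl N) : fracLap N α θ x =
    fracLapCoeff N α / 2 * ∫ z, ‖z‖ ^ (-((N : ℝ) + α)) * secondDiff θ z x := by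
  rw [fracLap]
  congr 2 with z
  rw [rpow_neg (norm_nonneg z), secondDiff, div_eq_mul_inv, mul_comm]

lemma integral_mul_secondDiff_swap (hN : 3 ≤ N) (hα : 0 < α) (hα2 : α < 2) {u θ : Eucl N → ℝ}
    (hu : Measurable u) (hu01 : ∀ x, u x ∈ Set.Icc (0 : ℝ) 1)
    (hθ : ContDiff ℝ (⊤ : ℕ∞) θ) (hc : HasCompactSupport θ) :
    ∫ z, ‖z‖ ^ (-((N : ℝ) + α)) * ∫ x, u x * secondDiff θ z x =
      ∫ x, u x * ∫ z, ‖z‖ ^ (-((N : ℝ) + α)) * secondDiff θ z x := by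
  have hθi : Integrable θ := hθ.continuous.integrable_of_hasCompactSupport hc
  have hθm : Measurable θ := hθ.continuous.measurable
  obtain ⟨A, hA0, hA⟩ := exists_integral_abs_secondDiff_le hθ hc
  have hmeas : AEStronglyMeasurable (fun w : Eucl N × Eucl N =>
      ‖w.1‖ ^ (-((N : ℝ) + α)) * (u w.2 * secondDiff θ w.1 w.2)) (volume.prod volume) := by
    unfold secondDiff
    refine Measurable.aestronglyMeasurable ?_
    fun_prop
  have hint : Integrable (fun w : Eucl N × Eucl N =>
      ‖w.1‖ ^ (-((N : ℝ) + α)) * (u w.2 * secondDiff θ w.1 w.2)) (volume.prod volume) := by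
    rw [integrable_prod_iff hmeas]
    have huδ := fun z => integrable_mul_of_mem_Icc (integrable_secondDiff hθi z) hu hu01
    refine ⟨.of_forall fun z => (huδ z).const_mul (‖z‖ ^ (-((N : ℝ) + α))), ?_⟩
    refine ((integrable_min_mul_rpow hN hα hα2).const_mul A).mono'
      hmeas.norm.integral_prod_right' (.of_forall fun z => ?_)
    have hz : 0 ≤ ‖z‖ ^ (-((N : ℝ) + α)) := rpow_nonneg (norm_nonneg z) _
    rw [Real.norm_of_nonneg (integral_nonneg fun x => norm_nonneg _)]
    simp only [norm_mul, Real.norm_of_nonneg hz]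
    rw [integral_const_mul]
    have h1 : ∫ x, ‖u x‖ * ‖secondDiff θ z x‖ ≤ ∫ x, |secondDiff θ z x| := by
      refine integral_mono ?_ (integrable_secondDiff hθi z).abs fun x => ?_
      · simpa only [norm_mul] using (huδ z).norm
      · rw [Real.norm_of_nonneg (hu01 x).1, Real.norm_eq_abs]
        exact mul_le_of_le_one_left (abs_nonneg _) (hu01 x).2
    have h2 := mul_le_mul_of_nonneg_left (h1.trans (hA z)) hz
    linarith
  have hsw := integral_integral_swap
    (f := fun z x => ‖z‖ ^ (-((N : ℝ) + α)) * (u x * secondDiff θ z x)) hint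
  calc _ = ∫ z, ∫ x, ‖z‖ ^ (-((N : ℝ) + α)) * (u x * secondDiff θ z x) := by
        simp only [integral_const_mul]
    _ = _ := hsw
    _ = _ := by
        congr 1 with x
        rw [← integral_const_mul]
        congr 1 with z
        ring

/-- The limit of the discrete solutions solves the limiting equation weakly. -/
theorem JumpApprox.weak_form {p v : ℕ → Eucl N → ℝ} {m : ℕ → ℝ}
    (hJ : JumpApprox N α C D D' p v m) {g : Eucl N → ℝ}
    (hg : RieszWeight N α g) (hN : 3 ≤ N) (hα : 0 < α) (hα2 : α < 2)
    {ψ : ℝ → ℝ} (hψc : Continuous ψ) (hψm : Monotone ψ) (hψnn : ∀ t, 0 ≤ ψ t)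
    {U : ℕ → Eucl N → ℝ} {σ : ℕ → ℕ} {u : Eucl N → ℝ}
    (hUm : ∀ n, Measurable (U n)) (hU01 : ∀ n x, U n x ∈ Set.Icc (0 : ℝ) 1)
    (hUeq : ∀ (n : ℕ) x, U n x + ((n : ℝ) + 1) ^ (-(α / 2)) * g x * ψ (U n x) =
        (∫ y, p n (x - y) * U n y) + (1 - m n))
    (hσ : StrictMono σ) (hlim : ∀ x, Tendsto (fun k => U (σ k) x) atTop (𝓝 (u x)))
    (huc : Continuous u) (hu01 : ∀ x, u x ∈ Set.Icc (0 : ℝ) 1)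
    {θ : Eucl N → ℝ} (hθ : ContDiff ℝ (⊤ : ℕ∞) θ) (hc : HasCompactSupport θ) :
    ∫ x, g x * ψ (u x) * θ x = (D' / fracLapCoeff N α) * ∫ x, u x * fracLap N α θ x := by
  have hθi : Integrable θ := hθ.continuous.integrable_of_hasCompactSupport hc
  have hθm : Measurable θ := hθ.continuous.measurable
  obtain ⟨A, hA0, hA⟩ := exists_integral_abs_secondDiff_le hθ hc
  have hpos : ∀ n : ℕ, 0 < ((n : ℝ) + 1) ^ (α / 2) := fun n => rpow_pos_of_pos (by positivity) _
  have hone : ∀ n : ℕ, ((n : ℝ) + 1) ^ (α / 2) * ((n : ℝ) + 1) ^ (-(α / 2)) = 1 := fun n => by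
    rw [← rpow_add (by positivity), add_neg_cancel, rpow_zero]
  have hdw := fun n => discrete_weak_form (hJ.p_int n) (hJ.p_neg n)
    (hJ.integral_p n) (hUm n) (hU01 n) hθi (hUeq n)
  have hid : ∀ n : ℕ, ∫ x, g x * ψ (U n x) * θ x =
      (1 / 2) * (∫ z, ((n : ℝ) + 1) ^ (α / 2) * p n z * ∫ x, U n x * secondDiff θ z x) +
      ((n : ℝ) + 1) ^ (α / 2) * (1 - m n) * ∫ x, (1 - U n x) * θ x := by
    intro n
    have h1 : ∫ x, g x * ψ (U n x) * θ x = ((n : ℝ) + 1) ^ (α / 2) *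
        ∫ x, ((n : ℝ) + 1) ^ (-(α / 2)) * g x * ψ (U n x) * θ x := by
      rw [← integral_const_mul]
      congr 1 with x
      linear_combination -(g x * ψ (U n x) * θ x) * hone n
    have h2 : ∫ z, ((n : ℝ) + 1) ^ (α / 2) * p n z * (∫ x, U n x * secondDiff θ z x) =
        ((n : ℝ) + 1) ^ (α / 2) * ∫ z, p n z * ∫ x, U n x * secondDiff θ z x := by
      rw [← integral_const_mul]
      congr 1 with z
      ring
    rw [h1, (hdw n).2, h2]
    ring
  have hL1 : Tendsto (fun k => ∫ x, g x * ψ (U (σ k) x) * θ x) atTop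
      (𝓝 (∫ x, g x * ψ (u x) * θ x)) := by
    refine tendsto_integral_of_dominated_convergence (fun x => ψ 1 * ‖g x * θ x‖)
      (fun k => ((hg.meas.mul (hψc.measurable.comp (hUm _))).mul hθm).aestronglyMeasurable)
      ((hg.integrable_mul hθ.continuous hc).norm.const_mul _)
      (fun k => .of_forall fun x => ?_) (.of_forall fun x => ?_)
    · rw [mul_right_comm, norm_mul, mul_comm, Real.norm_of_nonneg (hψnn _)]
      exact mul_le_mul_of_nonneg_right (hψm (hU01 _ x).2) (norm_nonneg _)
    · exact (((hψc.tendsto _).comp (hlim x)).const_mul (g x)).mul_const (θ x)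
  have hL2 : Tendsto (fun k => ∫ z, (((σ k : ℕ) : ℝ) + 1) ^ (α / 2) * p (σ k) z *
      ∫ x, U (σ k) x * secondDiff θ z x) atTop
      (𝓝 (∫ z, D' * ‖z‖ ^ (-((N : ℝ) + α)) * ∫ x, u x * secondDiff θ z x)) := by
    have hne : ∀ᵐ z : Eucl N, z ≠ 0 := by
      filter_upwards [ae_sub_ne_zero hN (0 : Eucl N)] with z hz
      simpa using hz
    refine tendsto_integral_of_dominated_convergence
      (fun z => C * A * (min 1 (‖z‖ ^ 2) * ‖z‖ ^ (-((N : ℝ) + α)))) (fun k => ?_)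
      ((integrable_min_mul_rpow hN hα hα2).const_mul _) (fun k => ?_) ?_
    · simpa only [mul_assoc] using ((hdw (σ k)).1.const_mul _).aestronglyMeasurable
    · filter_upwards [hne] with z hz
      have h1 := hJ.p_le (σ k) z hz
      have h2 := (abs_integral_mul_le (integrable_secondDiff hθi z) (hU01 (σ k))).trans (hA z)
      have h0 := mul_nonneg (hpos (σ k)).le (hJ.p_nonneg (σ k) z)
      rw [norm_mul, Real.norm_of_nonneg h0, Real.norm_eq_abs]
      calc _ ≤ (C * ‖z‖ ^ (-((N : ℝ) + α))) * (A * min 1 (‖z‖ ^ 2)) :=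
            mul_le_mul h1 h2 (abs_nonneg _) (h0.trans h1)
        _ = _ := by ring
    · filter_upwards [hne] with z hz
      refine ((hJ.p_lim z hz).comp hσ.tendsto_atTop).mul ?_
      refine tendsto_integral_of_dominated_convergence (fun x => |secondDiff θ z x|)
        (fun k => (integrable_mul_of_mem_Icc (integrable_secondDiff hθi z) (hUm _)
          (hU01 _)).aestronglyMeasurable) (integrable_secondDiff hθi z).abs
        (fun k => .of_forall fun x => ?_) (.of_forall fun x => (hlim x).mul_const _)
      rw [norm_mul, Real.norm_of_nonneg (hU01 _ x).1, Real.norm_eq_abs]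
      exact mul_le_of_le_one_left (abs_nonneg _) (hU01 _ x).2
  have hL3 : Tendsto (fun k => (((σ k : ℕ) : ℝ) + 1) ^ (α / 2) * (1 - m (σ k)) *
      ∫ x, (1 - U (σ k) x) * θ x) atTop (𝓝 0) := by
    have h := (hJ.m_lim.comp hσ.tendsto_atTop).mul_const (∫ x, |θ x|)
    rw [zero_mul] at h
    refine squeeze_zero_norm (fun k => ?_) h
    have h0 := mul_nonneg (hpos (σ k)).le (sub_nonneg.mpr (hJ.m_le (σ k)))
    rw [norm_mul, Real.norm_of_nonneg h0, Real.norm_eq_abs]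
    refine mul_le_mul_of_nonneg_left (abs_integral_mul_le hθi fun x => ?_) h0
    have := hU01 (σ k) x
    constructor <;> linarith [this.1, this.2]
  have hL := (hL2.const_mul (1 / 2)).add hL3
  simp only [← hid] at hL
  rw [tendsto_nhds_unique hL1 hL]
  have hcoef := fracLapCoeff_pos (N := N) hN hα hα2
  have hfr : ∫ x, u x * fracLap N α θ x = fracLapCoeff N α / 2 *
      ∫ x, u x * ∫ z, ‖z‖ ^ (-((N : ℝ) + α)) * secondDiff θ z x := by
    rw [← integral_const_mul]
    congr 1 with x
    rw [fracLap_eq]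
    ring
  simp only [mul_assoc]
  rw [integral_const_mul, integral_mul_secondDiff_swap hN hα hα2 huc.measurable hu01 hθ hc, hfr]
  field_simp
  ring

end weak

theorem exists_isEntireSol {N : ℕ} {α : ℝ} (hN : 3 ≤ N) (hα : 0 < α) (hα2 : α < 2)
    {ρ : Eucl N → ℝ} (hρ : RieszWeight N α ρ) {φ : ℝ → ℝ}
    (hφc : ContinuousOn φ (Set.Ici 0)) (hφm : MonotoneOn φ (Set.Ici 0)) (hφ0 : φ 0 = 0) :
    ∃ u : Eucl N → ℝ, IsEntireSol N α ρ φ u ∧ ∃ x, u x ≠ 0 := by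
  obtain ⟨C, D, D', p, v, m, hJ⟩ := exists_jumpApprox hN hα hα2
  have hcoef : 0 < fracLapCoeff N α := fracLapCoeff_pos hN hα hα2
  have hκ : 0 < D' / fracLapCoeff N α := div_pos hJ.D'_pos hcoef
  set κ := D' / fracLapCoeff N α
  have hg : RieszWeight N α fun x => κ * ρ x :=
    { meas := hρ.meas.const_mul κ
      nonneg := fun x => mul_nonneg hκ.le (hρ.nonneg x)
      bdd := fun R => by
        obtain ⟨M, hM⟩ := hρ.bdd R
        exact ⟨κ * M, fun x hx => mul_le_mul_of_nonneg_left (hM x hx) hκ.le⟩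
      int := by simpa only [mul_assoc] using hρ.int.const_mul κ }
  have hψc : Continuous fun t : ℝ => φ (max t 0) :=
    hφc.comp_continuous (by fun_prop) fun t => le_max_right t 0
  have hψm : Monotone fun t : ℝ => φ (max t 0) := fun s t hst =>
    hφm (le_max_right s 0) (le_max_right t 0) (max_le_max_right 0 hst)
  have hψ0 : ∀ t ≤ 0, φ (max t 0) = 0 := fun t ht => by rw [max_eq_right ht, hφ0]
  have hψnn : ∀ t, 0 ≤ φ (max t 0) := fun t => by
    exact hφ0.ge.trans (hφm Set.self_mem_Ici (le_max_right t 0) (le_max_right t 0))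
  obtain ⟨U, σ, u, hUm, hU01, hUeq, hσ, hlim, huc, hu01, hne⟩ :=
    hJ.exists_limit hg hN hα hα2 hψc hψm hψ0
  have hψu : ∀ x, φ (max (u x) 0) = φ (u x) := fun x => by rw [max_eq_left (hu01 x).1]
  have hψuc : Continuous fun x => φ (u x) := (hψc.comp huc).congr hψu
  refine ⟨u, ⟨huc, ⟨1, fun x => (hu01 x).2⟩, fun x => (hu01 x).1, ?_, fun θ hθ hc => ?_⟩, hne⟩
  · rw [locallyIntegrable_iff]
    intro k hk
    obtain ⟨R, hR⟩ := hk.isBounded.subset_closedBall 0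
    obtain ⟨M, hM⟩ := hρ.bdd R
    refine (integrableOn_const (C := M * φ 1) hk.measure_lt_top.ne).mono'
      (hρ.meas.mul hψuc.measurable).aestronglyMeasurable
      (ae_restrict_of_forall_mem hk.measurableSet fun x hx => ?_)
    have h0 : 0 ≤ φ (u x) := by rw [← hψu]; exact hψnn _
    rw [Real.norm_of_nonneg (mul_nonneg (hρ.nonneg x) h0)]
    have hx' := hM x (mem_closedBall_zero_iff.mp (hR hx))
    exact mul_le_mul hx' (hφm (hu01 x).1 (Set.mem_Ici.mpr zero_le_one) (hu01 x).2) h0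
      ((hρ.nonneg x).trans hx')
  · have h := hJ.weak_form hg hN hα hα2 hψc hψm hψnn hUm hU01 hUeq hσ hlim huc hu01 hθ hc
    simp only [hψu, mul_assoc] at h
    rw [integral_const_mul] at h
    rw [← mul_left_cancel₀ hκ.ne' h]
    simp only [mul_assoc]

/-- if `ρ*(r) = sup_{|x|=r} ρ(x)` satisfies `∫_η^∞ r^{α-1} ρ*(r) dr < ∞`
for some `η ≥ 0`, then `∫ ρ(y)|y|^{-(N-α)} dy < ∞`, and consequently
`Δ^{α/2}u = ρ·φ(u)` has a nontrivial nonnegative entire bounded solution. -/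
theorem stmt12 (N : ℕ) (hN : 3 ≤ N) (α : ℝ) (hα1 : 0 < α) (hα2 : α < 2)
    (ρ : EuclideanSpace ℝ (Fin N) → ℝ) (hρm : Measurable ρ) (hρnn : ∀ x, 0 ≤ ρ x)
    (hρlb : ∀ R : ℝ, ∃ M : ℝ, ∀ x : EuclideanSpace ℝ (Fin N), ‖x‖ ≤ R → ρ x ≤ M)
    (φ : ℝ → ℝ) (hφc : ContinuousOn φ (Set.Ici 0)) (hφm : MonotoneOn φ (Set.Ici 0))
    (hφ0 : φ 0 = 0) (hφnn : ∀ t : ℝ, 0 ≤ t → 0 ≤ φ t)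
    (ρstar : ℝ → ℝ)
    (hρstar : ∀ r : ℝ, ρstar r = sSup (ρ '' {x : EuclideanSpace ℝ (Fin N) | ‖x‖ = r}))
    (hyp : ∃ η : ℝ, 0 ≤ η ∧ IntegrableOn (fun r : ℝ => r ^ (α - 1) * ρstar r) (Set.Ioi η)) :
    Integrable (fun y : EuclideanSpace ℝ (Fin N) => ρ y * ‖y‖ ^ (-((N : ℝ) - α))) ∧
    ∃ u : EuclideanSpace ℝ (Fin N) → ℝ, IsEntireSol N α ρ φ u ∧ ∃ x, u x ≠ 0 := by
  obtain ⟨η, -, hη⟩ := hyp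
  have hint := integrable_mul_rieszK hN hα1 hρm hρnn hρlb hρstar hη
  refine ⟨?_, exists_isEntireSol hN hα1 hα2 ⟨hρm, hρnn, hρlb, hint⟩ hφc hφm hφ0⟩
  simpa only [neg_sub, rieszK] using hint
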